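/- arXiv:1111.0587 — 3 statements merged into one kernel-verified Lean document; each statement's English description precedes it below -/
import Mathlib

section
/- Let m ≥ 7 be odd and let n be an integer with binom(m−1, ⌊m/2⌋−1) + m − 3⌊m/2⌋ < n ≤ binom(m−1, ⌊m/2⌋−1). Then CAN(3, n+1, 2) ≥ 2·CAN(2, n, 2) + 1. -/
/-- An `m × n` matrix over `B_q = {0,…,q-1}` is a `t`-covering array if for any `t`
distinct column indices and any `q`-ary vector of length `t`, some row realizes it. -/
def IsCoveringArray (m n q t : ℕ) (C : Fin m → Fin n → Fin q) : Prop :=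
  ∀ cols : Fin t → Fin n, Function.Injective cols →
    ∀ v : Fin t → Fin q, ∃ r : Fin m, ∀ j : Fin t, C r (cols j) = v j

/-- `CAN t n q` : the minimal size `m` for which a `CA(m; t, n, q)` exists. -/
noncomputable def CAN (t n q : ℕ) : ℕ :=
  sInf { m | ∃ C : Fin m → Fin n → Fin q, IsCoveringArray m n q t C }

/-- The weight of the `i`-th column: the number of nonzero entries. -/
def colWt {m n q : ℕ} (C : Fin m → Fin n → Fin q) (i : Fin n) : ℕ :=
  (Finset.univ.filter fun r : Fin m => (C r i : ℕ) ≠ 0).card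

/-- The support of the `i`-th column: the set of coordinates where it is nonzero. -/
def colSupp {m n q : ℕ} (C : Fin m → Fin n → Fin q) (i : Fin n) : Finset (Fin m) :=
  Finset.univ.filter fun r : Fin m => (C r i : ℕ) ≠ 0

/-- The Hamming distance between the `i`-th and `j`-th columns. -/
def colDist {m n q : ℕ} (C : Fin m → Fin n → Fin q) (i j : Fin n) : ℕ :=
  (Finset.univ.filter fun r : Fin m => C r i ≠ C r j).card

/-- Two arrays are equivalent if one is obtained from the other by a row permutation,
a column permutation, and value permutations applied columnwise. -/
def CAEquiv {m n q : ℕ} (C C' : Fin m → Fin n → Fin q) : Prop :=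
  ∃ (σ : Equiv.Perm (Fin m)) (τ : Equiv.Perm (Fin n)) (f : Fin n → Equiv.Perm (Fin q)),
    ∀ r i, C' r i = f i (C (σ r) (τ i))

/-- The standard maximal binary 2-covering array of size `m` : an
`m × (m-1).choose (m/2 - 1)` binary matrix whose first row is all ones and whose columns,
restricted to the remaining `m - 1` rows, are exactly (i.e. are pairwise distinct) the binary
vectors of length `m-1` with `m/2 - 1` ones. -/
def IsStandardMaxArray (m : ℕ) (S : Fin m → Fin ((m-1).choose (m/2 - 1)) → Fin 2) : Prop :=
  (∀ (r : Fin m) (i), (r : ℕ) = 0 → S r i = 1) ∧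
  (Function.Injective fun i => fun r => S r i) ∧
  (∀ i, (Finset.univ.filter fun r : Fin m => (r : ℕ) ≠ 0 ∧ S r i = 1).card = m/2 - 1)

section RouxBound

open Finset FinsetFamily

/-- The sets `X i` are pairwise qualitatively independent: any two distinct ones meet, are
incomparable, and do not cover the ground set. -/
def QualIndep {α ι : Type*} (X : ι → Finset α) : Prop :=
  ∀ i j, i ≠ j → (∃ r, r ∈ X i ∧ r ∈ X j) ∧ (∃ r, r ∈ X i ∧ r ∉ X j) ∧ (∃ r, r ∉ X i ∧ r ∉ X j)

/-- The Erdős–Ko–Rado theorem over an arbitrary finite ground set. -/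
theorem erdos_ko_rado_fintype {α : Type*} [Fintype α] [DecidableEq α] {𝒰 : Finset (Finset α)}
    {r : ℕ} (hI : (𝒰 : Set (Finset α)).Intersecting) (hs : (𝒰 : Set (Finset α)).Sized r)
    (hr : r ≤ Fintype.card α / 2) : #𝒰 ≤ (Fintype.card α - 1).choose (r - 1) := by
  have e := (Fintype.equivFin α).toEmbedding
  rw [← card_map (mapEmbedding e).toEmbedding]
  apply erdos_ko_rado _ _ hr
  · intro a ha b hb
    simp only [coe_map, Set.mem_image, mem_coe] at ha hb
    obtain ⟨a, ha, rfl⟩ := ha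
    obtain ⟨b, hb, rfl⟩ := hb
    simpa using hI ha hb
  · intro a ha
    simp only [coe_map, Set.mem_image, mem_coe] at ha
    obtain ⟨a, ha, rfl⟩ := ha
    simpa using hs ha

namespace QualIndep

variable {α ι : Type*} {X : ι → Finset α}

theorem not_subset (h : QualIndep X) {i j : ι} (hij : i ≠ j) : ¬ X i ⊆ X j := by
  obtain ⟨-, ⟨r, h1, h2⟩, -⟩ := h i j hij
  exact fun hs => h2 (hs h1)

theorem injective (h : QualIndep X) : Function.Injective X := by
  intro i j hij
  by_contra hne
  exact h.not_subset hne hij.subset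

variable [Fintype α] [DecidableEq α]

/-- Qualitative independence survives complementing some of the sets. -/
theorem compl_some (h : QualIndep X) (p : ι → Prop) [DecidablePred p] :
    QualIndep fun i => if p i then X i else (X i)ᶜ := by
  intro i j hij
  have h1 := h i j hij
  have h2 := h j i hij.symm
  by_cases hi : p i <;> by_cases hj : p j <;> simp only [hi, hj, if_true, if_false, mem_compl] <;>
    grind

variable [Fintype ι]

/-- By Sperner's theorem, few sets on a small ground set are qualitatively independent. -/
theorem two_mul_card_le [Nontrivial ι] (h : QualIndep X) :
    2 * Fintype.card ι ≤ (Fintype.card α).choose (Fintype.card α / 2) := by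
  let g : Bool × ι → Finset α := fun p => if p.1 then X p.2 else (X p.2)ᶜ
  have hg : ∀ p q, p ≠ q → ¬ g p ⊆ g q := by
    rintro ⟨a, i⟩ ⟨b, j⟩ hne hs
    rcases eq_or_ne i j with rfl | hij
    · obtain ⟨j, hij⟩ := exists_ne i
      have h1 := h i j hij.symm
      cases a <;> cases b <;> simp_all [g]
    · have h1 := h i j hij
      have h2 := h j i hij.symm
      cases a <;> cases b <;> simp [g, subset_iff] at hs <;> grind
  have hinj : Function.Injective g := by
    intro p q hpq
    by_contra hne
    exact hg p q hne hpq.subset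
  have hanti : IsAntichain (· ⊆ ·) ((univ.map ⟨g, hinj⟩ : Finset (Finset α)) : Set (Finset α)) := by
    intro a ha b hb hab
    simp only [coe_map, Set.mem_image, Function.Embedding.coeFn_mk] at ha hb
    obtain ⟨p, -, rfl⟩ := ha
    obtain ⟨q, -, rfl⟩ := hb
    exact hg p q fun hpq => hab (by rw [hpq])
  have := hanti.sperner
  simpa using this

/-- Erdős–Ko–Rado for the sets of size `k + 1` below qualitatively independent ones. -/
theorem card_falling_le [Nontrivial ι] {k : ℕ} (hα : Fintype.card α = 2 * k + 1)
    (h : QualIndep X) : #(falling (k + 1) (univ.map ⟨X, h.injective⟩)) ≤ (2 * k).choose (k - 1) := by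
  set 𝒰 := falling (k + 1) (univ.map ⟨X, h.injective⟩)
  have hmem : ∀ s ∈ 𝒰, (∃ i, s ⊆ X i) ∧ #s = k + 1 := by
    intro s hs
    simpa [𝒰, mem_falling] using hs
  rw [← card_compls]
  convert erdos_ko_rado_fintype (𝒰 := 𝒰ᶜˢ) (r := k) _ _ (by omega) using 2
  · omega
  · intro a ha b hb hab
    obtain ⟨⟨i, hi⟩, -⟩ := hmem _ (mem_compls.1 ha)
    obtain ⟨⟨j, hj⟩, -⟩ := hmem _ (mem_compls.1 hb)
    obtain ⟨r, h1, h2⟩ : ∃ r, r ∉ X i ∧ r ∉ X j := by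
      rcases eq_or_ne i j with rfl | hij
      · obtain ⟨j, hij⟩ := exists_ne i
        obtain ⟨-, -, r, h1, -⟩ := h i j hij.symm
        exact ⟨r, h1, h1⟩
      · exact (h i j hij).2.2
    have hra : r ∈ a := by
      by_contra hr
      exact h1 (hi (mem_compl.2 hr))
    have hrb : r ∈ b := by
      by_contra hr
      exact h2 (hj (mem_compl.2 hr))
    exact Finset.disjoint_left.1 hab hra hrb
  · intro a ha
    have := (hmem _ (mem_compls.1 ha)).2
    rw [card_compl] at this
    have := card_le_univ a
    omega

end QualIndep

theorem choose_mul_le_of_odd (k j : ℕ) :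
    (2 * k + 1).choose (k + 1 + j) * (k + j * (j + 1)) ≤ k * (2 * k + 1).choose (k + 1) := by
  induction j with
  | zero => simp [mul_comm]
  | succ j ih =>
    refine le_trans ?_ ih
    have h := Nat.choose_succ_right_eq (2 * k + 1) (k + 1 + j)
    rcases le_or_gt k j with hkj | hkj
    · rw [Nat.choose_eq_zero_of_lt (by omega)]
      simp
    · obtain ⟨d, rfl⟩ := Nat.exists_eq_add_of_lt hkj
      rw [show 2 * (j + d + 1) + 1 - (j + d + 1 + 1 + j) = d + 1 by omega] at h
      refine Nat.le_of_mul_le_mul_right (c := j + d + 1 + 1 + j + 1) ?_ (by omega)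
      calc _ = ((2 * (j + d + 1) + 1).choose (j + d + 1 + 1 + j + 1) * (j + d + 1 + 1 + j + 1))
            * (j + d + 1 + (j + 1) * (j + 1 + 1)) := by
              rw [show j + d + 1 + 1 + (j + 1) = j + d + 1 + 1 + j + 1 by ring]; ring
        _ = (2 * (j + d + 1) + 1).choose (j + d + 1 + 1 + j) *
            ((d + 1) * (j + d + 1 + (j + 1) * (j + 1 + 1))) := by rw [h]; ring
        _ ≤ (2 * (j + d + 1) + 1).choose (j + d + 1 + 1 + j) *
            ((j + d + 1 + j * (j + 1)) * (j + d + 1 + 1 + j + 1)) := by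
              gcongr ?_ * ?_
              · exact le_rfl
              nlinarith [Nat.zero_le (j*j*j), Nat.zero_le (j * j), Nat.zero_le (j*d)]
        _ = _ := by ring

theorem sq_card_compl_of_odd {α : Type*} [Fintype α] [DecidableEq α] {k : ℕ}
    (hα : Fintype.card α = 2 * k + 1) (s : Finset α) :
    (2 * #sᶜ - (2 * k + 1) : ℝ) ^ 2 = (2 * #s - (2 * k + 1)) ^ 2 := by
  have h1 := card_compl_add_card s
  have h2 : (#sᶜ : ℝ) = 2 * k + 1 - #s := by
    rw [eq_sub_iff_add_eq]
    exact_mod_cast h1.trans hα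
  rw [h2]
  ring

namespace QualIndep

variable {α ι : Type*} [Fintype α] [DecidableEq α] [Fintype ι] {X : ι → Finset α}

theorem sum_le_of_lt_card [Nontrivial ι] {k : ℕ} (hk : 0 < k) (hα : Fintype.card α = 2 * k + 1)
    (h : QualIndep X) (hX : ∀ i, k < #(X i)) :
    ∑ i, ((2 * #(X i) - (2 * k + 1)) ^ 2 + (4 * k - 1) : ℝ) ≤
      4 * k * (2 * k).choose (k - 1) := by
  have hanti : IsAntichain (· ⊆ ·)
      ((univ.map ⟨X, h.injective⟩ : Finset (Finset α)) : Set (Finset α)) := by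
    intro a ha b hb hab
    simp only [coe_map, Set.mem_image, Function.Embedding.coeFn_mk] at ha hb
    obtain ⟨p, -, rfl⟩ := ha
    obtain ⟨q, -, rfl⟩ := hb
    exact h.not_subset fun hpq => hab (by rw [hpq])
  have key := le_card_falling_div_choose (𝕜 := ℝ) (k := k) (by omega) hanti
  rw [show Fintype.card α - k = k + 1 by omega] at key
  have hsum : ∑ r ∈ range (k + 1),
        (#((univ.map ⟨X, h.injective⟩ : Finset (Finset α)) # (Fintype.card α - r)) : ℝ) /
          (Fintype.card α).choose (Fintype.card α - r)
      = ∑ i, (((2 * k + 1).choose #(X i) : ℝ))⁻¹ := by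
    have h1 : ∀ i ∈ (univ : Finset ι), Fintype.card α - #(X i) ∈ range (k + 1) := by
      intro i _
      have := hX i
      simp only [mem_range]
      omega
    rw [← sum_fiberwise_of_maps_to h1]
    refine sum_congr rfl fun r hr => ?_
    rw [mem_range] at hr
    have h2 : ∀ i ∈ (univ : Finset ι).filter (fun i => Fintype.card α - #(X i) = r),
        (((2 * k + 1).choose #(X i) : ℝ))⁻¹
          = ((Fintype.card α).choose (Fintype.card α - r) : ℝ)⁻¹ := by
      intro i hi
      rw [mem_filter] at hi
      have := card_le_univ (X i)
      rw [hα, show #(X i) = 2 * k + 1 - r by omega]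
    rw [sum_congr rfl h2, sum_const, nsmul_eq_mul, div_eq_mul_inv]
    congr 2
    rw [slice, filter_map, card_map]
    congr 1
    ext i
    have := card_le_univ (X i)
    simp
    omega
  rw [hsum, hα] at key
  have hc : (0 : ℝ) < (2 * k + 1).choose (k + 1) := by
    exact_mod_cast Nat.choose_pos (by omega)
  rw [le_div_iff₀ hc, sum_mul] at key
  have h3 : (#(falling (k + 1) (univ.map ⟨X, h.injective⟩)) : ℝ) ≤ (2 * k).choose (k - 1) := by
    exact_mod_cast h.card_falling_le hα
  calc _ ≤ ∑ i, 4 * k *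
        (((2 * k + 1).choose #(X i) : ℝ)⁻¹ * (2 * k + 1).choose (k + 1)) := by
        refine sum_le_sum fun i _ => ?_
        obtain ⟨j, hj⟩ := Nat.exists_eq_add_of_lt (hX i)
        have h4 := choose_mul_le_of_odd k j
        have h5 : (0 : ℝ) < (2 * k + 1).choose #(X i) := by
          have := card_le_univ (X i)
          exact_mod_cast Nat.choose_pos (by omega)
        rw [show k + 1 + j = #(X i) by omega] at h4
        have h6 : (((2 * k + 1).choose #(X i) * (k + j * (j + 1)) : ℕ) : ℝ) ≤
          ((k * (2 * k + 1).choose (k + 1) : ℕ) : ℝ) := by exact_mod_cast h4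
        push_cast at h6
        rw [inv_mul_eq_div, mul_div_assoc', le_div_iff₀ h5]
        have h7 : (#(X i) : ℝ) = k + j + 1 := by exact_mod_cast hj
        generalize ((2 * k + 1).choose #(X i) : ℝ) = c at *
        rw [h7]
        linarith
    _ = 4 * k * ∑ i, (((2 * k + 1).choose #(X i) : ℝ)⁻¹ * (2 * k + 1).choose (k + 1)) := by
        rw [mul_sum]
    _ ≤ _ := by gcongr; exact key.trans h3

/-- A weighted form of the bound on the number of qualitatively independent sets on `2 * k + 1`
points, penalizing the sets whose size is not `k` or `k + 1`. -/
theorem sum_le [Nontrivial ι] {k : ℕ} (hk : 0 < k) (hα : Fintype.card α = 2 * k + 1)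
    (h : QualIndep X) :
    ∑ i, ((2 * #(X i) - (2 * k + 1)) ^ 2 + (4 * k - 1) : ℝ) ≤
      4 * k * (2 * k).choose (k - 1) := by
  refine le_trans (le_of_eq ?_) ((h.compl_some fun i => k < #(X i)).sum_le_of_lt_card hk hα ?_)
  · refine sum_congr rfl fun i _ => ?_
    split_ifs
    · rfl
    · rw [sq_card_compl_of_odd hα]
  · intro i
    split_ifs
    · assumption
    · rw [card_compl]
      omega

theorem card_add_le_of_lt_card [Nontrivial ι] {k : ℕ} (hα : Fintype.card α = 2 * k + 1)
    (h : QualIndep X) (i₀ : ι) (h0 : k + 1 < #(X i₀)) (hX : ∀ i, i ≠ i₀ → #(X i) = k + 1) :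
    Fintype.card ι + k + 1 ≤ (2 * k).choose (k - 1) := by
  classical
  refine le_trans ?_ (h.card_falling_le hα)
  obtain ⟨s, hs, hsc⟩ := exists_subset_card_eq (show k + 2 ≤ #(X i₀) from h0)
  have hdisj : Disjoint ((univ.erase i₀).map ⟨X, h.injective⟩) (powersetCard (k + 1) s) := by
    rw [Finset.disjoint_left]
    intro a ha hb
    rw [mem_map] at ha
    obtain ⟨i, hi, rfl⟩ := ha
    exact h.not_subset (ne_of_mem_erase hi) ((mem_powersetCard.1 hb).1.trans hs)
  have hcard : #((univ.erase i₀).map ⟨X, h.injective⟩ ∪ powersetCard (k + 1) s)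
      = Fintype.card ι + k + 1 := by
    rw [card_union_of_disjoint hdisj, card_map, card_erase_of_mem (mem_univ _), card_powersetCard,
      hsc, Nat.choose_succ_self_right, card_univ]
    have := Fintype.card_pos_iff.2 ⟨i₀⟩
    omega
  rw [← hcard]
  refine card_le_card (union_subset ?_ ?_)
  · intro a ha
    rw [mem_map] at ha
    obtain ⟨i, hi, rfl⟩ := ha
    rw [mem_falling]
    exact ⟨⟨X i, by simp, Subset.rfl⟩, hX i (ne_of_mem_erase hi)⟩
  · intro a ha
    rw [mem_powersetCard] at ha
    rw [mem_falling]
    exact ⟨⟨X i₀, by simp, ha.1.trans hs⟩, ha.2⟩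

/-- On `2 * k + 1` points, if one of the sets does not have size `k` or `k + 1` and all the others
do, then there are few sets. -/
theorem card_add_le [Nontrivial ι] {k : ℕ} (hα : Fintype.card α = 2 * k + 1)
    (h : QualIndep X) (i₀ : ι) (h0 : #(X i₀) < k ∨ k + 1 < #(X i₀))
    (hX : ∀ i, i ≠ i₀ → #(X i) = k ∨ #(X i) = k + 1) :
    Fintype.card ι + k + 1 ≤ (2 * k).choose (k - 1) := by
  refine (h.compl_some fun i => k < #(X i)).card_add_le_of_lt_card hα i₀ ?_ fun i hi => ?_
  · split_ifs
    · omega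
    · rw [card_compl]
      omega
  · have := hX i hi
    split_ifs
    · omega
    · rw [card_compl]
      omega

end QualIndep

/-- A Welch-type bound: vectors with zero coordinate sums cannot all have small inner products. -/
theorem sum_sq_norm_le_sum_sq_inner {α ι : Type*} [Fintype α] [Fintype ι] [Nonempty α]
    (y : ι → α → ℝ) (hy : ∀ i, ∑ r, y i r = 0) :
    (∑ i, ∑ r, y i r ^ 2) ^ 2 ≤
      (Fintype.card α - 1) * ∑ i, ∑ j, (∑ r, y i r * y j r) ^ 2 := by
  classical
  set N := (Fintype.card α : ℝ) with hN
  have hN0 : N ≠ 0 := by simp [hN]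
  set G : α × α → ℝ := fun p => ∑ i, y i p.1 * y i p.2 with hG
  set Q : α × α → ℝ := fun p => (if p.1 = p.2 then 1 else 0) - 1 / N with hQ
  have hGQ : ∑ p, G p * Q p = ∑ i, ∑ r, y i r ^ 2 := by
    have h0 : ∑ p, G p = 0 := by
      rw [hG, sum_comm]
      refine sum_eq_zero fun i _ => ?_
      rw [Fintype.sum_prod_type]
      simp [← mul_sum, hy]
    simp only [hQ, mul_sub, sum_sub_distrib, ← sum_mul, h0]
    rw [Fintype.sum_prod_type]
    simp only [mul_ite, mul_one, mul_zero, sum_ite_eq, mem_univ, if_true, hG, zero_mul, sub_zero]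
    rw [sum_comm]
    simp only [sq]
  have hQQ : ∑ p, Q p ^ 2 = N - 1 := by
    have h1 : ∀ p, Q p ^ 2 = (if p.1 = p.2 then 1 - 2 / N else 0) + 1 / N ^ 2 := by
      intro p
      simp only [hQ]
      split_ifs
      · field_simp
        ring
      · field_simp
        ring
    simp only [h1, sum_add_distrib]
    rw [Fintype.sum_prod_type]
    simp [← hN]
    field_simp
    ring
  have hGG : ∑ p, G p ^ 2 = ∑ i, ∑ j, (∑ r, y i r * y j r) ^ 2 := by
    simp only [hG, sq, sum_mul_sum, Fintype.sum_prod_type]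
    rw [sum_congr rfl fun x _ => sum_comm, sum_comm]
    refine sum_congr rfl fun i _ => ?_
    rw [sum_congr rfl fun x _ => sum_comm, sum_comm]
    refine sum_congr rfl fun j _ => sum_congr rfl fun x _ => sum_congr rfl fun x' _ => ?_
    ring
  have := sum_mul_sq_le_sq_mul_sq univ G Q
  rw [hGQ, hQQ, hGG] at this
  linarith

/-- Vectors of length `7` with entries `1` and `-1` and coordinate sums `1`, any two of which have
inner product between `-1` and `3`, have large total inner product. -/
theorem le_sum_inner_of_card_eq_seven {α ι : Type*} [Fintype α] [Fintype ι]
    (hα : Fintype.card α = 7) (z : ι → α → ℝ) (hz : ∀ i r, z i r ^ 2 = 1)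
    (hsum : ∀ i, ∑ r, z i r = 1)
    (hlo : ∀ i j, i ≠ j → -1 ≤ ∑ r, z i r * z j r)
    (hhi : ∀ i j, i ≠ j → ∑ r, z i r * z j r ≤ 3) :
    59 / 21 * (Fintype.card ι : ℝ) ^ 2 - 56 / 3 * Fintype.card ι ≤
      ∑ i, ∑ j, ∑ r, z i r * z j r := by
  classical
  have : Nonempty α := Fintype.card_pos_iff.1 (by omega)
  have hα' : (Fintype.card α : ℝ) = 7 := by exact_mod_cast hα
  have key := sum_sq_norm_le_sum_sq_inner (fun i r => z i r - 1 / 7) fun i => by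
    simp [hsum, hα']
  have h1 : ∀ i, ∑ r, (z i r - 1 / 7) ^ 2 = 48 / 7 := by
    intro i
    simp only [sub_sq, hz, sum_add_distrib, sum_sub_distrib, mul_assoc, ← mul_sum, ← sum_mul, hsum]
    simp [hα']
    norm_num
  have h2 : ∀ i j, ∑ r, (z i r - 1 / 7) * (z j r - 1 / 7) = ∑ r, z i r * z j r - 1 / 7 := by
    intro i j
    simp only [sub_mul, mul_sub, sum_sub_distrib, ← mul_sum, ← sum_mul, hsum]
    simp [hα']
  have h3 : ∀ i j, (∑ r, z i r * z j r - 1 / 7) ^ 2 ≤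
      12 / 7 * (∑ r, z i r * z j r) + 3 + 1 / 49 + if i = j then 32 else 0 := by
    intro i j
    split_ifs with hij
    · subst hij
      have : ∑ r, z i r * z i r = 7 := by
        simp [← sq, hz, hα']
      rw [this]
      norm_num
    · nlinarith [hlo i j hij, hhi i j hij]
  simp only [h1, h2, hα'] at key
  have h4 := key.trans (mul_le_mul_of_nonneg_left
    (sum_le_sum fun i _ => sum_le_sum fun j _ => h3 i j) (by norm_num))
  simp only [sum_add_distrib, ← mul_sum] at h4
  simp at h4
  linarith

theorem QualIndep.card_eq_three_or_four {α ι : Type*} [Fintype α] [DecidableEq α] [Fintype ι]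
    {X : ι → Finset α} (h : QualIndep X) (hα : Fintype.card α = 7) (hι : 14 ≤ Fintype.card ι)
    (i : ι) : #(X i) = 3 ∨ #(X i) = 4 := by
  classical
  have : Nontrivial ι := Fintype.one_lt_card_iff_nontrivial.1 (by omega)
  by_contra hi
  have hge : ∀ j, ¬ (#(X j) = 3 ∨ #(X j) = 4) → (8 : ℝ) ≤ (2 * #(X j) - 7) ^ 2 - 1 := by
    intro j hj
    rcases (by omega : #(X j) ≤ 2 ∨ 5 ≤ #(X j)) with h1 | h1
    · have : (#(X j) : ℝ) ≤ 2 := by exact_mod_cast h1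
      nlinarith
    · have : (5 : ℝ) ≤ #(X j) := by exact_mod_cast h1
      nlinarith
  have hnonneg : ∀ j, (0 : ℝ) ≤ (2 * #(X j) - 7) ^ 2 - 1 := by
    intro j
    by_cases hj : #(X j) = 3 ∨ #(X j) = 4
    · rcases hj with hj | hj <;> rw [hj] <;> norm_num
    · linarith [hge j hj]
  have hsum : ∑ j, ((2 * #(X j) - 7) ^ 2 - 1 : ℝ) ≤ 12 := by
    have h1 := h.sum_le (k := 3) (by norm_num) hα
    norm_num [Nat.choose, sum_add_distrib] at h1
    have h2 : (14 : ℝ) ≤ Fintype.card ι := by exact_mod_cast hι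
    simp only [sum_sub_distrib, sum_const, card_univ, nsmul_eq_mul]
    linarith
  have := h.card_add_le (k := 3) hα i (by omega) fun j hj => by
    by_contra hj'
    have h1 := sum_le_sum_of_subset_of_nonneg (subset_univ {i, j}) fun l _ _ => hnonneg l
    rw [sum_pair hj.symm] at h1
    linarith [hge i hi, hge j hj']
  norm_num [Nat.choose] at this
  omega

/-- Sign vectors of length `7` with coordinate sums `1` or `-1`, any two of which realize all four
sign patterns, have large total inner product once normalized to coordinate sum `1`. -/
theorem le_sum_inner_of_sign_vectors {α ι : Type*} [Fintype α] [Fintype ι]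
    (hα : Fintype.card α = 7) (y : ι → α → ℝ) (hy : ∀ i r, y i r ^ 2 = 1)
    (hsum : ∀ i, (∑ r, y i r) ^ 2 = 1)
    (hcov : ∀ i j, i ≠ j → ∀ a b : ℝ, a ^ 2 = 1 → b ^ 2 = 1 → ∃ r, y i r = a ∧ y j r = b) :
    59 / 21 * (Fintype.card ι : ℝ) ^ 2 - 56 / 3 * Fintype.card ι ≤
      ∑ i, ∑ j, (∑ r, y i r) * (∑ r, y j r) * ∑ r, y i r * y j r := by
  have hα' : (Fintype.card α : ℝ) = 7 := by exact_mod_cast hα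
  set e : ι → ℝ := fun i => ∑ r, y i r with he
  have hz : ∀ i r, (e i * y i r) ^ 2 = 1 := fun i r => by rw [mul_pow, hy, mul_one]; exact hsum i
  have hzs : ∀ i, ∑ r, e i * y i r = 1 := fun i => by
    rw [← mul_sum, ← sq]
    exact hsum i
  have hle : ∀ i r, e i * y i r ≤ 1 ∧ -1 ≤ e i * y i r := fun i r => by
    constructor <;> nlinarith [hz i r]
  refine (le_sum_inner_of_card_eq_seven hα (fun i r => e i * y i r) hz hzs ?_ ?_).trans_eq ?_
  · intro i j hij
    obtain ⟨r, h1, h2⟩ := hcov i j hij (-e i) (-e j) (by rw [neg_sq]; exact hsum i)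
      (by rw [neg_sq]; exact hsum j)
    have h3 := single_le_sum (f := fun r => (1 - e i * y i r) * (1 - e j * y j r))
      (fun r _ => mul_nonneg (by linarith [hle i r]) (by linarith [hle j r])) (mem_univ r)
    simp only [h1, h2] at h3
    simp only [sub_mul, mul_sub, sum_sub_distrib, one_mul, mul_one, hzs] at h3
    simp only [sum_const, card_univ, nsmul_eq_mul, hα', mul_one] at h3
    have := hsum i
    have := hsum j
    simp only [he] at *
    nlinarith
  · intro i j hij
    obtain ⟨r, h1, h2⟩ := hcov i j hij (-e i) (e j) (by rw [neg_sq]; exact hsum i) (hsum j)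
    have h3 := single_le_sum (f := fun r => (1 - e i * y i r) * (1 + e j * y j r))
      (fun r _ => mul_nonneg (by linarith [hle i r]) (by linarith [hle j r])) (mem_univ r)
    simp only [h1, h2] at h3
    simp only [sub_mul, mul_add, sum_sub_distrib, sum_add_distrib, one_mul, mul_one, hzs] at h3
    simp only [sum_const, card_univ, nsmul_eq_mul, hα', mul_one] at h3
    have := hsum i
    have := hsum j
    simp only [he] at *
    nlinarith
  · refine sum_congr rfl fun i _ => sum_congr rfl fun j _ => ?_
    rw [mul_sum]
    exact sum_congr rfl fun r _ => by ring

/-- The columns of a binary array as sign vectors. -/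
def colSign {m n : ℕ} (C : Fin m → Fin n → Fin 2) (i : Fin n) (r : Fin m) : ℝ :=
  if C r i = 1 then 1 else -1

theorem colSign_sq {m n : ℕ} (C : Fin m → Fin n → Fin 2) (i : Fin n) (r : Fin m) :
    colSign C i r ^ 2 = 1 := by
  unfold colSign
  split_ifs <;> norm_num

theorem sum_colSign_subtype {m n : ℕ} (C : Fin m → Fin n → Fin 2) (i : Fin n) (p : Fin m → Prop)
    [DecidablePred p] : ∑ r : {r // p r}, colSign C i r =
      2 * #{r : {r // p r} | C r i = 1} - Fintype.card {r // p r} := by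
  have h : ∀ r : {r // p r}, colSign C i r = 2 * (if C r i = 1 then 1 else 0) - 1 := by
    intro r
    unfold colSign
    split_ifs <;> norm_num
  simp only [h, sum_sub_distrib, ← mul_sum]
  simp

/-- The rows of an array where a given column has a given value. -/
abbrev RowsWith {m n : ℕ} (C : Fin m → Fin n → Fin 2) (c : Fin n) (b : Fin 2) : Type :=
  {r : Fin m // C r c = b}

theorem sum_eq_sum_rowsWith {m n : ℕ} (C : Fin m → Fin n → Fin 2) (c : Fin n) (f : Fin m → ℝ) :
    ∑ r, f r = ∑ r : RowsWith C c 1, f r + ∑ r : RowsWith C c 0, f r := by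
  rw [← Fintype.sum_subtype_add_sum_subtype (fun r => C r c = 1) f]
  congr 1
  exact Fintype.sum_equiv (Equiv.subtypeEquivRight fun r => by omega) _ _ fun _ => rfl

namespace IsCoveringArray

variable {m n k : ℕ} {C : Fin m → Fin n → Fin 2}

theorem exists_row (hC : IsCoveringArray m n 2 3 C) {c i j : Fin n} (hi : i ≠ c) (hj : j ≠ c)
    (hij : i ≠ j) (a b d : Fin 2) : ∃ r, C r c = a ∧ C r i = b ∧ C r j = d := by
  obtain ⟨r, hr⟩ := hC ![c, i, j] (by
    intro x y
    fin_cases x <;> fin_cases y <;> simp [hi, hj, hij, hi.symm, hj.symm, hij.symm]) ![a, b, d]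
  exact ⟨r, hr 0, hr 1, hr 2⟩

theorem exists_row_colSign (hC : IsCoveringArray m n 2 3 C) {c i j : Fin n} (hi : i ≠ c)
    (hj : j ≠ c) (hij : i ≠ j) (d : Fin 2) (a b : ℝ) (ha : a ^ 2 = 1) (hb : b ^ 2 = 1) :
    ∃ r : RowsWith C c d, colSign C i r = a ∧ colSign C j r = b := by
  have key : ∀ a : ℝ, a ^ 2 = 1 → ∃ v : Fin 2, (if v = 1 then 1 else -1) = a := by
    intro a ha
    rcases sq_eq_one_iff.1 ha with rfl | rfl
    · exact ⟨1, by simp⟩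
    · exact ⟨0, by simp⟩
  obtain ⟨v, hv⟩ := key a ha
  obtain ⟨w, hw⟩ := key b hb
  obtain ⟨r, h0, h1, h2⟩ := hC.exists_row hi hj hij d v w
  exact ⟨⟨r, h0⟩, by simp [colSign, h1, hv], by simp [colSign, h2, hw]⟩

theorem qualIndep (hC : IsCoveringArray m n 2 3 C) (c : Fin n) (b : Fin 2) :
    QualIndep fun i : {i // i ≠ c} => ({r : RowsWith C c b | C r i = 1} : Finset _) := by
  intro i j hij
  have key := fun v w => hC.exists_row i.2 j.2 (Subtype.coe_ne_coe.2 hij) b v w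
  refine ⟨?_, ?_, ?_⟩
  · obtain ⟨r, h0, h1, h2⟩ := key 1 1
    exact ⟨⟨r, h0⟩, by simp [h1], by simp [h2]⟩
  · obtain ⟨r, h0, h1, h2⟩ := key 1 0
    exact ⟨⟨r, h0⟩, by simp [h1], by simp [h2]⟩
  · obtain ⟨r, h0, h1, h2⟩ := key 0 0
    exact ⟨⟨r, h0⟩, by simp [h1], by simp [h2]⟩

end IsCoveringArray

theorem nine_mul_le_choose {k : ℕ} (hk : 4 ≤ k) : 9 * k ≤ (2 * k).choose (k - 1) := by
  induction k, hk using Nat.le_induction with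
  | base => decide
  | succ k hk ih =>
    obtain ⟨l, rfl⟩ := Nat.exists_eq_add_of_le' (show 1 ≤ k by omega)
    have h1 := Nat.choose_succ_succ (2 * (l + 1) + 1) l
    have h2 := Nat.choose_succ_succ (2 * (l + 1)) l
    have h3 := Nat.choose_le_choose l (show 2 * (l + 1) ≤ 2 * (l + 1) + 1 by omega)
    simp only [Nat.succ_eq_add_one, Nat.add_sub_cancel] at *
    rw [show 2 * (l + 1 + 1) = 2 * (l + 1) + 1 + 1 by ring]
    omega

theorem five_mul_le_choose {k : ℕ} (hk : 3 ≤ k) : 5 * k ≤ (2 * k).choose (k - 1) := by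
  rcases hk.eq_or_lt with rfl | hk
  · decide
  · have := nine_mul_le_choose hk
    omega

theorem choose_lt_two_mul {k n : ℕ} (hk : 3 ≤ k) (hn : (2 * k).choose (k - 1) + 2 ≤ n + k) :
    (2 * k).choose k < 2 * n := by
  obtain ⟨l, rfl⟩ := Nat.exists_eq_add_of_le' (show 1 ≤ k by omega)
  have h1 := Nat.choose_succ_right_eq (2 * (l + 1)) l
  have h2 := five_mul_le_choose hk
  rw [Nat.add_sub_cancel] at h2 hn
  rw [show 2 * (l + 1) - l = l + 2 by omega] at h1
  by_contra! h
  have h3 := Nat.mul_le_mul_right (l + 1) h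
  rw [h1] at h3
  zify at *
  nlinarith

namespace IsCoveringArray

variable {m n k : ℕ} {C : Fin m → Fin (n + 1) → Fin 2}

theorem card_rowsWith (hC : IsCoveringArray m (n + 1) 2 3 C) (hn : 2 ≤ n)
    (hlt : (2 * k).choose k < 2 * n) (hm : m ≤ 4 * k + 2) (c : Fin (n + 1)) (b : Fin 2) :
    Fintype.card (RowsWith C c b) = 2 * k + 1 := by
  have hι : Fintype.card {i // i ≠ c} = n := by simp
  have : Nontrivial {i // i ≠ c} := Fintype.one_lt_card_iff_nontrivial.1 (by omega)
  have hge : ∀ b, 2 * k + 1 ≤ Fintype.card (RowsWith C c b) := by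
    intro b
    by_contra! hb
    have h1 := (hC.qualIndep c b).two_mul_card_le
    have h2 := Nat.choose_le_choose (Fintype.card (RowsWith C c b) / 2)
      (show Fintype.card (RowsWith C c b) ≤ 2 * k by omega)
    have h3 := Nat.choose_le_middle (Fintype.card (RowsWith C c b) / 2) (2 * k)
    rw [Nat.mul_div_cancel_left k two_pos] at h3
    omega
  have hsum := sum_eq_sum_rowsWith C c fun _ => 1
  simp only [sum_const, card_univ, nsmul_eq_mul, mul_one, Fintype.card_fin] at hsum
  norm_cast at hsum
  have h0 := hge 0
  have h1 := hge 1
  fin_cases b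
  · change Fintype.card (RowsWith C c 0) = _
    omega
  · change Fintype.card (RowsWith C c 1) = _
    omega

end IsCoveringArray

section Balanced

variable {m n k : ℕ} {C : Fin m → Fin n → Fin 2}

theorem sum_colSign_eq_zero (hcard : ∀ c b, Fintype.card (RowsWith C c b) = 2 * k + 1)
    (c : Fin n) : ∑ r, colSign C c r = 0 := by
  rw [sum_eq_sum_rowsWith C c]
  have h1 : ∀ r : RowsWith C c 1, colSign C c r = 1 := fun r => by simp [colSign, r.2]
  have h0 : ∀ r : RowsWith C c 0, colSign C c r = -1 := fun r => by simp [colSign, r.2]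
  simp [h1, h0, hcard]

theorem sum_rowsWith_zero (hcard : ∀ c b, Fintype.card (RowsWith C c b) = 2 * k + 1)
    (c i : Fin n) :
    ∑ r : RowsWith C c 0, colSign C i r = -∑ r : RowsWith C c 1, colSign C i r := by
  have := sum_colSign_eq_zero hcard i
  rw [sum_eq_sum_rowsWith C c] at this
  linarith

theorem inner_colSign (hcard : ∀ c b, Fintype.card (RowsWith C c b) = 2 * k + 1)
    (c i : Fin n) :
    ∑ r, colSign C c r * colSign C i r = 2 * ∑ r : RowsWith C c 1, colSign C i r := by
  rw [sum_eq_sum_rowsWith C c]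
  have h1 : ∀ r : RowsWith C c 1, colSign C c r = 1 := fun r => by simp [colSign, r.2]
  have h0 : ∀ r : RowsWith C c 0, colSign C c r = -1 := fun r => by simp [colSign, r.2]
  simp only [h1, h0, one_mul, neg_one_mul, sum_neg_distrib, sum_rowsWith_zero hcard]
  ring

theorem sum_rowsWith_one (hcard : ∀ c b, Fintype.card (RowsWith C c b) = 2 * k + 1)
    (c i : Fin n) : ∑ r : RowsWith C c 1, colSign C i r =
      2 * #{r : RowsWith C c 1 | C r i = 1} - (2 * k + 1) := by
  rw [sum_colSign_subtype, hcard]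
  push_cast
  rfl

end Balanced

namespace IsCoveringArray

variable {m n k : ℕ} {C : Fin m → Fin (n + 1) → Fin 2}

theorem sum_sq_inner_le (hC : IsCoveringArray m (n + 1) 2 3 C) (hk : 0 < k) (hn : 2 ≤ n)
    (hcard : ∀ c b, Fintype.card (RowsWith C c b) = 2 * k + 1) (c : Fin (n + 1)) :
    ∑ i, (∑ r, colSign C c r * colSign C i r) ^ 2 ≤
      (m : ℝ) ^ 2 + 4 * (4 * k * (2 * k).choose (k - 1) - n * (4 * k - 1)) := by
  have hι : Fintype.card {i // i ≠ c} = n := by simp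
  have : Nontrivial {i // i ≠ c} := Fintype.one_lt_card_iff_nontrivial.1 (by omega)
  have h1 := (hC.qualIndep c 1).sum_le hk (hcard c 1)
  simp only [← sum_rowsWith_one hcard, sum_add_distrib, sum_const, card_univ, hι,
    nsmul_eq_mul] at h1
  rw [Fintype.sum_eq_add_sum_subtype_ne _ c]
  have h2 : ∑ r, colSign C c r * colSign C c r = m := by
    simp [← sq, colSign_sq]
  rw [h2]
  simp only [inner_colSign hcard, mul_pow, ← mul_sum]
  linarith

/-- For `k ≥ 4` a balanced covering array has few columns, by the Welch-type bound. -/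
theorem add_le_choose_add (hC : IsCoveringArray m (n + 1) 2 3 C) (hk : 4 ≤ k) (hn : 2 ≤ n)
    (hcard : ∀ c b, Fintype.card (RowsWith C c b) = 2 * k + 1) (hm : m = 4 * k + 2) :
    n + k ≤ (2 * k).choose (k - 1) + 1 := by
  by_contra! hlt
  have hne : Nonempty (Fin m) := ⟨⟨0, by omega⟩⟩
  have key := sum_sq_norm_le_sum_sq_inner (colSign C) (sum_colSign_eq_zero hcard)
  simp only [colSign_sq, sum_const, card_univ, Fintype.card_fin, nsmul_eq_mul, mul_one] at key
  have hm1 : (0 : ℝ) ≤ m - 1 := by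
    rw [hm]
    push_cast
    linarith
  have h1 := key.trans (mul_le_mul_of_nonneg_left
    (sum_le_sum fun c _ => hC.sum_sq_inner_le (by omega) hn hcard c) hm1)
  simp only [sum_const, card_univ, Fintype.card_fin, nsmul_eq_mul] at h1
  have h2 : ((2 * k).choose (k - 1) : ℝ) + 2 ≤ n + k := by exact_mod_cast hlt
  have h3 : (9 : ℝ) * k ≤ (2 * k).choose (k - 1) := by exact_mod_cast nine_mul_le_choose hk
  have h4 : (4 : ℝ) ≤ k := by exact_mod_cast hk
  have h5 : (m : ℝ) = 4 * k + 2 := by rw [hm]; push_cast; ring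
  set b := ((2 * k).choose (k - 1) : ℝ)
  push_cast at h1
  set R : ℝ := (m : ℝ) ^ 2 + 4 * (4 * k * b - n * (4 * k - 1)) with hR
  have hM : (0 : ℝ) < n + 1 := by positivity
  have hR0 : 0 ≤ R := by
    have : 0 ≤ (m - 1) * ((n + 1) * R) := le_trans (by positivity) h1
    have h6 : (0 : ℝ) < (m - 1) * (n + 1) := mul_pos (by linarith) hM
    nlinarith
  have h6 : (n + 1) * (m : ℝ) ≤ R := by
    have h7 : (m - 1) * ((n + 1) * R) ≤ m * ((n + 1) * R) := by
      have : 0 ≤ (n + 1) * R := by positivity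
      nlinarith
    have h8 := h1.trans h7
    have h9 : (0 : ℝ) < m * (n + 1) := mul_pos (by linarith) hM
    refine le_of_mul_le_mul_left (a := m * (n + 1 : ℝ)) ?_ h9
    linarith
  have h7 : R ≤ (m : ℝ) ^ 2 + 4 * (4 * k * (k - 2) + n) := by
    nlinarith
  rw [h5] at h6 h7
  nlinarith

/-- There is no balanced covering array of size `14` with more than `14` columns. -/
theorem lt_fourteen (hC : IsCoveringArray m (n + 1) 2 3 C)
    (hcard : ∀ c b, Fintype.card (RowsWith C c b) = 7) (hm : m = 14) : n < 14 := by
  by_contra! hn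
  have hι : ∀ c : Fin (n + 1), Fintype.card {i // i ≠ c} = n := by simp
  have hcard' : ∀ c b, Fintype.card (RowsWith C c b) = 2 * 3 + 1 := hcard
  have hone : ∀ c i, i ≠ c → (∑ r : RowsWith C c 1, colSign C i r) ^ 2 = 1 := by
    intro c i hi
    rw [sum_rowsWith_one hcard']
    rcases (hC.qualIndep c 1).card_eq_three_or_four (hcard c 1) (by rw [hι]; exact hn) ⟨i, hi⟩
      with h | h <;> rw [h] <;> norm_num
  have hcov := fun d (i j : {i : Fin (n + 1) // i ≠ 0}) (hij : i ≠ j) =>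
    hC.exists_row_colSign i.2 j.2 (Subtype.coe_ne_coe.2 hij) d
  have h1 := le_sum_inner_of_sign_vectors (hcard 0 1)
    (fun (i : {i : Fin (n + 1) // i ≠ 0}) r => colSign C i r) (fun i r => colSign_sq C i r)
    (fun i => hone 0 i i.2) (hcov 1)
  have h0 := le_sum_inner_of_sign_vectors (hcard 0 0)
    (fun (i : {i : Fin (n + 1) // i ≠ 0}) r => colSign C i r) (fun i r => colSign_sq C i r)
    (fun i => by rw [sum_rowsWith_zero hcard', neg_sq]; exact hone 0 i i.2) (hcov 0)
  simp only [sum_rowsWith_zero hcard', neg_mul_neg] at h0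
  have hsum := add_le_add h1 h0
  simp only [← sum_add_distrib, ← mul_add] at hsum
  have hle : ∀ i j : {i : Fin (n + 1) // i ≠ 0},
      (∑ r : RowsWith C 0 1, colSign C i r) * (∑ r : RowsWith C 0 1, colSign C j r) *
        (∑ r : RowsWith C 0 1, colSign C i r * colSign C j r +
          ∑ r : RowsWith C 0 0, colSign C i r * colSign C j r) ≤ 2 + if i = j then 12 else 0 := by
    intro i j
    rw [← sum_eq_sum_rowsWith C 0 fun r => colSign C i r * colSign C j r]
    split_ifs with hij
    · subst hij
      rw [← sq, hone 0 i i.2]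
      simp only [← sq, colSign_sq]
      simp [hm]
      norm_num
    · rw [inner_colSign hcard']
      refine le_trans (le_abs_self _) (le_of_eq ?_)
      have habs : ∀ c i, i ≠ c → |∑ r : RowsWith C c 1, colSign C i r| = 1 := by
        intro c i hi
        rcases sq_eq_one_iff.1 (hone c i hi) with h | h <;> rw [h] <;> norm_num
      rw [abs_mul, abs_mul, abs_mul, habs 0 i i.2, habs 0 j j.2,
        habs i j (Subtype.coe_ne_coe.2 (Ne.symm hij))]
      norm_num
  have h2 := hsum.trans (sum_le_sum fun i _ => sum_le_sum fun j _ => hle i j)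
  simp only [sum_add_distrib, sum_ite_eq, mem_univ, if_true, sum_const, card_univ, hι,
    nsmul_eq_mul] at h2
  have h3 : (14 : ℝ) ≤ n := by exact_mod_cast hn
  nlinarith

theorem lt_size (hC : IsCoveringArray m (n + 1) 2 3 C) (hk : 3 ≤ k)
    (hn : (2 * k).choose (k - 1) + 2 ≤ n + k) : 4 * k + 2 < m := by
  by_contra! hm
  have h5 := five_mul_le_choose hk
  have hn2 : 2 ≤ n := by omega
  have hcard := hC.card_rowsWith hn2 (choose_lt_two_mul hk hn) hm
  have hsum := sum_eq_sum_rowsWith C 0 fun _ => 1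
  simp only [sum_const, card_univ, nsmul_eq_mul, mul_one, Fintype.card_fin, hcard] at hsum
  norm_cast at hsum
  rcases hk.eq_or_lt with rfl | hk
  · have := hC.lt_fourteen hcard (by omega)
    norm_num [Nat.choose] at hn
    omega
  · have := hC.add_le_choose_add hk hn2 hcard (by omega)
    omega

end IsCoveringArray

theorem exists_coveringArray (t n q : ℕ) [NeZero q] :
    ∃ m, ∃ C : Fin m → Fin n → Fin q, IsCoveringArray m n q t C := by
  refine ⟨_, (Fintype.equivFin (Fin n → Fin q)).symm, fun cols hcols v => ?_⟩
  exact ⟨Fintype.equivFin _ (Function.extend cols v fun _ => 0), fun j => by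
    simp [hcols.extend_apply]⟩

/-- The standard array, whose columns are the `k`-subsets of the rows that contain a given row,
has strength two. -/
theorem exists_coveringArray_two {k n : ℕ} (hk : 0 < k) (hn : n ≤ (2 * k).choose (k - 1)) :
    ∃ C : Fin (2 * k + 1) → Fin n → Fin 2, IsCoveringArray (2 * k + 1) n 2 2 C := by
  have hcard : Fintype.card (Fin n) ≤
      Fintype.card (powersetCard (k - 1) (univ : Finset (Fin (2 * k)))) := by
    simpa using hn
  obtain ⟨A⟩ := Function.Embedding.nonempty_of_card_le hcard
  have hA : ∀ i, #(A i).1 = k - 1 := fun i => (mem_powersetCard.1 (A i).2).2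
  refine ⟨Fin.cons (fun _ => 1) fun r i => if r ∈ (A i).1 then 1 else 0, fun cols hcols v => ?_⟩
  have hne : ∀ a b : Fin 2, a ≠ b → ∃ r, r ∈ (A (cols a)).1 ∧ r ∉ (A (cols b)).1 := by
    intro a b hab
    by_contra! hsub
    exact hab (hcols (A.injective (Subtype.ext (eq_of_subset_of_card_le hsub (by rw [hA, hA])))))
  have hcov : ∃ r, r ∉ (A (cols 0)).1 ∧ r ∉ (A (cols 1)).1 := by
    by_contra! hcov
    have h1 := card_le_card (show univ ⊆ (A (cols 0)).1 ∪ (A (cols 1)).1 from fun r _ => by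
      rw [mem_union]
      by_contra! h
      exact h.2 (hcov r h.1))
    have h2 := card_union_le (A (cols 0)).1 (A (cols 1)).1
    rw [hA, hA] at h2
    rw [card_univ, Fintype.card_fin] at h1
    omega
  rcases (by omega : v 0 = 0 ∨ v 0 = 1) with h0 | h0 <;>
    rcases (by omega : v 1 = 0 ∨ v 1 = 1) with h1 | h1
  · obtain ⟨r, hr0, hr1⟩ := hcov
    exact ⟨r.succ, by simp [Fin.forall_fin_two, *]⟩
  · obtain ⟨r, hr1, hr0⟩ := hne 1 0 (by decide)
    exact ⟨r.succ, by simp [Fin.forall_fin_two, *]⟩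
  · obtain ⟨r, hr0, hr1⟩ := hne 0 1 (by decide)
    exact ⟨r.succ, by simp [Fin.forall_fin_two, *]⟩
  · exact ⟨0, by simp [Fin.forall_fin_two, *]⟩

end RouxBound

/-- improved Roux bound, odd case: for odd `m ≥ 7` and
`binom(m-1,⌊m/2⌋-1) + m - 3⌊m/2⌋ < n ≤ binom(m-1,⌊m/2⌋-1)` we have
`CAN(3,n+1,2) ≥ 2·CAN(2,n,2) + 1`. -/
theorem improved_roux_odd (m n : ℕ) (hm : 7 ≤ m) (hodd : Odd m)
    (hn1 : (m-1).choose (m/2 - 1) + m < n + 3 * (m/2))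
    (hn2 : n ≤ (m-1).choose (m/2 - 1)) :
    2 * CAN 2 n 2 + 1 ≤ CAN 3 (n+1) 2 := by
  obtain ⟨k, rfl⟩ := hodd
  rw [show (2 * k + 1) / 2 = k by omega, Nat.add_sub_cancel] at hn1 hn2
  refine le_csInf (exists_coveringArray 3 (n + 1) 2) ?_
  rintro N ⟨C, hC⟩
  have h1 : CAN 2 n 2 ≤ 2 * k + 1 := Nat.sInf_le (exists_coveringArray_two (by omega) hn2)
  have h2 := hC.lt_size (k := k) (by omega) (by omega)
  omega
end

section
/- Let m ≥ 8 be even and let n be an integer with binom(m−1, m/2−1) − m/2 < n ≤ binom(m−1, m/2−1). Then CAN(3, n+1, 2) ≥ 2·CAN(2, n, 2) + 2; equivalently, there is no (2m+1) × (n+1) binary 3-covering array. -/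
theorem Nat.choose_le_choose_of_le_half {n r s : ℕ} (hrs : r ≤ s) (hs : s ≤ n / 2) :
    n.choose r ≤ n.choose s := by
  induction s, hrs using Nat.le_induction with
  | base => rfl
  | succ s _ ih => exact (ih (by omega)).trans (Nat.choose_le_succ_of_lt_half_left (by omega))

section Shadow
open Finset
open scoped FinsetFamily

variable {α : Type*} [DecidableEq α]

/-- The neighbours of a `(k + 1)`-set `B` inside a `(k + 1)`-uniform family `ℬ` (obtained by
exchanging one element) are at most as many as the shadow elements of `ℬ` outside the shadow
of `B`. -/
lemma card_exchange_le_card_shadow_sdiff [Fintype α] {k : ℕ} (hk : 2 ≤ k)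
    {ℬ : Finset (Finset α)} {B : Finset α} (hB : #B = k + 1) :
    #{p ∈ B ×ˢ Bᶜ | insert p.2 (B.erase p.1) ∈ ℬ} ≤ #(∂ ℬ \ ∂ {B}) := by
  have key := card_mul_le_card_mul (s := {p ∈ B ×ˢ Bᶜ | insert p.2 (B.erase p.1) ∈ ℬ})
    (t := ∂ ℬ \ ∂ {B}) (m := k) (n := 2)
    (fun p S => ∃ z ∈ B.erase p.1, S = (insert p.2 (B.erase p.1)).erase z) ?_ ?_
  · nlinarith
  · rintro ⟨x, y⟩ hp
    simp only [mem_filter, mem_product, mem_compl] at hp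
    obtain ⟨⟨hx, hy⟩, hT⟩ := hp
    have hcard : #((B.erase x).image fun z => (insert y (B.erase x)).erase z) = k := by
      rw [card_image_of_injOn, card_erase_of_mem hx, hB, Nat.add_sub_cancel]
      intro z hz w hw h
      exact (erase_inj _ (mem_insert_of_mem hz)).1 h
    rw [← hcard]
    refine card_le_card fun S hS => ?_
    obtain ⟨z, hz, rfl⟩ := mem_image.1 hS
    have hzB := mem_of_mem_erase hz
    rw [mem_bipartiteAbove, mem_sdiff]
    refine ⟨⟨erase_mem_shadow hT (mem_insert_of_mem hz), fun h => ?_⟩, z, hz, rfl⟩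
    obtain ⟨B', hB', h⟩ := exists_subset_of_mem_shadow h
    rw [mem_singleton.1 hB'] at h
    exact hy (h (mem_erase.2 ⟨by rintro rfl; exact hy hzB, mem_insert_self _ _⟩))
  · intro S hS
    by_cases hne : ({p ∈ B ×ˢ Bᶜ | insert p.2 (B.erase p.1) ∈ ℬ}.bipartiteBelow
      (fun p S => ∃ z ∈ B.erase p.1, S = (insert p.2 (B.erase p.1)).erase z) S).Nonempty
    · obtain ⟨⟨x, y⟩, hp⟩ := hne
      simp only [mem_bipartiteBelow, mem_filter, mem_product, mem_compl] at hp
      obtain ⟨⟨⟨hx, hy⟩, hT⟩, z, hz, hS⟩ := hp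
      refine (card_le_card (t := {(x, y), (z, y)}) ?_).trans card_le_two
      rintro ⟨x', y'⟩ hp
      simp only [mem_bipartiteBelow, mem_filter, mem_product, mem_compl] at hp
      obtain ⟨⟨⟨hx', hy'⟩, hT'⟩, z', hz', hS'⟩ := hp
      have hx'S : x' ∉ S := by grind
      have hy'S : y' ∈ S := by grind
      grind
    · rw [not_nonempty_iff_eq_empty.1 hne]; simp

lemma card_shadow_singleton (B : Finset α) : #(∂ {B}) = #B := by
  rw [shadow, sup_singleton, card_image_of_injOn]
  exact fun z hz w hw h => (erase_inj _ hz).1 h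

/-- In a ground set of size `2 * k`, the shadow of a nonempty `(k + 1)`-uniform family exceeds the
family by at least `k`. -/
theorem card_add_le_card_shadow [Fintype α] {k : ℕ} (hk : 2 ≤ k) (hα : Fintype.card α = 2 * k)
    {ℬ : Finset (Finset α)} (hℬ : (ℬ : Set (Finset α)).Sized (k + 1)) (hne : ℬ.Nonempty) :
    #ℬ + k ≤ #(∂ ℬ) := by
  obtain ⟨B, hBℬ⟩ := hne
  have hB : #B = k + 1 := hℬ hBℬ
  set P : Finset (Σ _ : Finset α, α) := (∂ ℬ).sigma fun S => Sᶜ with hP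
  have hPcard : #P = #(∂ ℬ) * k := by
    rw [hP, card_sigma, sum_const_nat]
    intro S hS
    have : #S = k := hℬ.shadow hS
    rw [card_compl, hα, this]; omega
  have hin : #{p ∈ P | insert p.2 p.1 ∈ ℬ} = #ℬ * (k + 1) := by
    rw [← sum_const_nat (f := fun T : Finset α => #T) fun T hT => hℬ hT]
    rw [← card_sigma ℬ fun T => T]
    refine card_nbij' (fun p => ⟨insert p.2 p.1, p.2⟩) (fun p => ⟨p.1.erase p.2, p.2⟩) ?_ ?_ ?_ ?_
    · rintro ⟨S, y⟩ h
      simp_all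
    · rintro ⟨T, y⟩ h
      simp only [coe_sigma, Set.mem_sigma_iff, mem_coe] at h
      simp [hP, h.2, h.1, erase_mem_shadow h.1 h.2]
    · rintro ⟨S, y⟩ h
      simp only [hP, coe_filter, Set.mem_ofPred_eq, mem_sigma, mem_compl] at h
      simp [h.1.2]
    · rintro ⟨T, y⟩ h
      simp only [coe_sigma, Set.mem_sigma_iff, mem_coe] at h
      simp [h.2]
  have hout : #{p ∈ B ×ˢ Bᶜ | insert p.2 (B.erase p.1) ∉ ℬ} ≤ #{p ∈ P | insert p.2 p.1 ∉ ℬ} := by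
    refine card_le_card_of_injOn (fun p => ⟨B.erase p.1, p.2⟩) ?_ ?_
    · rintro ⟨x, y⟩ h
      simp only [coe_filter, mem_product, mem_compl, Set.mem_ofPred_eq] at h
      simp [hP, erase_mem_shadow hBℬ h.1.1, h.1.2, h.2]
    · rintro ⟨x, y⟩ h ⟨x', y'⟩ h' heq
      simp only [coe_filter, mem_product, mem_compl, Set.mem_ofPred_eq] at h h'
      simp only [Sigma.mk.injEq, heq_eq_eq] at heq
      rw [(erase_inj _ h.1.1).1 heq.1, heq.2]
  have hsplit := card_filter_add_card_filter_not (s := P) (fun p => insert p.2 p.1 ∈ ℬ)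
  have hsplit' := card_filter_add_card_filter_not (s := B ×ˢ Bᶜ)
    (fun p => insert p.2 (B.erase p.1) ∈ ℬ)
  rw [card_product, card_compl, hα, hB] at hsplit'
  have hext := card_exchange_le_card_shadow_sdiff hk (ℬ := ℬ) hB
  have hsd := card_sdiff_add_card_eq_card (shadow_mono (singleton_subset_iff.2 hBℬ))
  rw [card_shadow_singleton, hB] at hsd
  obtain ⟨j, rfl⟩ := Nat.exists_eq_add_of_le hk
  rw [show 2 * (2 + j) - (2 + j + 1) = j + 1 by omega] at hsplit'
  nlinarith

/-- The `k`-sets below a nonempty antichain of large sets outnumber it by at least `k`. -/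
theorem card_add_le_card_falling [Fintype α] {k : ℕ} (hk : 2 ≤ k) (hα : Fintype.card α = 2 * k)
    {𝒰 : Finset (Finset α)} (h𝒰 : IsAntichain (· ⊆ ·) (𝒰 : Set (Finset α)))
    (hlarge : ∀ A ∈ 𝒰, k < #A) (hne : 𝒰.Nonempty) : #𝒰 + k ≤ #(falling k 𝒰) := by
  have hle : #𝒰 ≤ #(falling (k + 1) 𝒰) := by
    have h := le_card_falling_div_choose (𝕜 := ℚ) (k := k - 1) (by omega) h𝒰
    rw [hα, show 2 * k - (k - 1) = k + 1 by omega] at h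
    have hpos : (0 : ℚ) < (2 * k).choose (k + 1) := by
      exact_mod_cast Nat.choose_pos (by omega)
    have hsum : (#𝒰 : ℚ) = ∑ r ∈ range (k - 1 + 1), (#(𝒰 # (2 * k - r)) : ℚ) := by
      rw [card_eq_sum_card_fiberwise (f := fun A => 2 * k - #A) (t := range (k - 1 + 1))]
      · push_cast
        refine sum_congr rfl fun r hr => ?_
        congr 2
        ext A
        have := card_le_univ A
        simp only [mem_filter, mem_slice, mem_range] at hr ⊢
        refine and_congr_right fun _ => ?_
        omega
      · intro A hA
        have := hlarge A hA
        have := card_le_univ A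
        simp only [coe_range, Set.mem_Iio]
        omega
    have : (#𝒰 : ℚ) / (2 * k).choose (k + 1) ≤ #(falling (k + 1) 𝒰) / (2 * k).choose (k + 1) := by
      refine le_trans ?_ h
      rw [hsum, sum_div]
      refine sum_le_sum fun r hr => ?_
      have hr := mem_range.1 hr
      refine div_le_div_of_nonneg_left (by positivity) ?_ ?_
      · exact_mod_cast Nat.choose_pos (by omega)
      · rw [Nat.choose_symm (by omega), ← Nat.choose_symm (n := 2 * k) (k := k + 1) (by omega)]
        exact_mod_cast Nat.choose_le_choose_of_le_half (by omega) (by omega)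
    exact_mod_cast (div_le_div_iff_of_pos_right hpos).1 this
  have hsub : ∂ (falling (k + 1) 𝒰) ⊆ falling k 𝒰 := by
    rw [← slice_union_shadow_falling_succ (k := k)]; exact subset_union_right
  have := card_pos.2 hne
  have := card_add_le_card_shadow hk hα (sized_falling (k + 1) 𝒰) (card_pos.1 (by omega))
  have := card_le_card hsub
  omega
/-- Stability in Sperner's theorem for self-complementary antichains on `2 * k` points: if some
member is outside the middle layer, the antichain misses the optimum by at least `2 * k`. -/
theorem IsAntichain.card_add_le_choose_of_compl_mem [Fintype α] {k : ℕ} (hk : 2 ≤ k)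
    (hα : Fintype.card α = 2 * k) {𝒜 : Finset (Finset α)}
    (h𝒜 : IsAntichain (· ⊆ ·) (𝒜 : Set (Finset α))) (hcompl : ∀ A ∈ 𝒜, Aᶜ ∈ 𝒜)
    (hmid : ∃ A ∈ 𝒜, #A ≠ k) : #𝒜 + 2 * k ≤ (2 * k).choose k := by
  have hcard (A : Finset α) : #A + #Aᶜ = 2 * k := by rw [card_add_card_compl, hα]
  set 𝒰 := {A ∈ 𝒜 | k < #A} with h𝒰
  have hne : 𝒰.Nonempty := by
    obtain ⟨A, hA, hAk⟩ := hmid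
    have := hcard A
    rcases lt_or_gt_of_ne hAk with h | h
    · exact ⟨Aᶜ, mem_filter.2 ⟨hcompl A hA, by omega⟩⟩
    · exact ⟨A, mem_filter.2 ⟨hA, h⟩⟩
  have hF : #𝒰 + k ≤ #(falling k 𝒰) := card_add_le_card_falling hk hα
    (h𝒜.subset (coe_subset.2 (filter_subset _ _))) (fun A hA => (mem_filter.1 hA).2) hne
  have hsplit : #𝒜 ≤ #{A ∈ 𝒜 | #A = k} + 2 * #𝒰 := by
    have hsub : 𝒜 ⊆ {A ∈ 𝒜 | #A = k} ∪ (𝒰 ∪ 𝒰.image compl) := by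
      intro A hA
      have := hcard A
      have hAc := hcompl A hA
      simp only [h𝒰, mem_union, mem_filter, mem_image]
      rcases lt_trichotomy #A k with h | h | h
      · exact .inr (.inr ⟨Aᶜ, ⟨hAc, by omega⟩, compl_compl A⟩)
      · exact .inl ⟨hA, h⟩
      · exact .inr (.inl ⟨hA, h⟩)
    have h1 := card_le_card hsub
    have h2 := card_union_le {A ∈ 𝒜 | #A = k} (𝒰 ∪ 𝒰.image compl)
    have h3 := card_union_le 𝒰 (𝒰.image compl)
    have h4 : #(𝒰.image compl) ≤ #𝒰 := card_image_le
    omega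
  have hdisj : Disjoint {A ∈ 𝒜 | #A = k} (falling k 𝒰) := by
    refine disjoint_left.2 fun S hS hSF => ?_
    obtain ⟨⟨T, hT, hST⟩, -⟩ := mem_falling.1 hSF
    rw [mem_filter] at hS hT
    have := h𝒜.eq hS.1 hT.1 hST
    subst this
    omega
  have hdisj' : Disjoint {A ∈ 𝒜 | #A = k} ((falling k 𝒰).image compl) := by
    refine disjoint_left.2 fun S hS hSF => ?_
    obtain ⟨S', hS', rfl⟩ := mem_image.1 hSF
    rw [mem_filter] at hS
    refine disjoint_left.1 hdisj (mem_filter.2 ⟨?_, (mem_falling.1 hS').2⟩) hS'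
    simpa using hcompl _ hS.1
  have hdisj'' : Disjoint (falling k 𝒰) ((falling k 𝒰).image compl) := by
    refine disjoint_left.2 fun S hS hSF => ?_
    obtain ⟨S', hS', rfl⟩ := mem_image.1 hSF
    obtain ⟨⟨T, hT, hST⟩, -⟩ := mem_falling.1 hS
    obtain ⟨⟨T', hT', hST'⟩, -⟩ := mem_falling.1 hS'
    rw [mem_filter] at hT hT'
    have := h𝒜.eq (hcompl _ hT'.1) hT.1 ((compl_subset_compl.2 hST').trans hST)
    have := hcard T'
    rw [‹T'ᶜ = T›] at this
    omega
  have hbound : #({A ∈ 𝒜 | #A = k} ∪ (falling k 𝒰 ∪ (falling k 𝒰).image compl)) ≤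
      (2 * k).choose k := by
    rw [← hα, ← card_univ, ← card_powersetCard]
    refine card_le_card fun S hS => mem_powersetCard.2 ⟨subset_univ _, ?_⟩
    simp only [mem_union, mem_filter, mem_image] at hS
    rcases hS with hS | hS | ⟨S', hS', rfl⟩
    · exact hS.2
    · exact (mem_falling.1 hS).2
    · have := (mem_falling.1 hS').2
      have := hcard S'
      omega
  rw [card_union_of_disjoint (disjoint_union_right.2 ⟨hdisj, hdisj'⟩),
    card_union_of_disjoint hdisj'', card_image_of_injective _ compl_injective] at hbound
  omega
end Shadow

section Covering
open Finset

/-- The strength-two covering property for a binary array with arbitrary row and column types. -/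
def IsTwoCovering {R ι : Type*} (f : R → ι → Fin 2) : Prop :=
  ∀ i j, i ≠ j → ∀ v w, ∃ r, f r i = v ∧ f r j = w

namespace IsTwoCovering

variable {R ι : Type*} [Fintype R] [Fintype ι] [Nontrivial ι] {f : R → ι → Fin 2}

/-- In a large two-covering array with `2 * k` rows every column is balanced. -/
theorem card_fiber_eq (hf : IsTwoCovering f) {k : ℕ} (hk : 2 ≤ k) (hR : Fintype.card R = 2 * k)
    (hι : (2 * k).choose k < 2 * Fintype.card ι + 2 * k) (i : ι) (v : Fin 2) :
    #{r | f r i = v} = k := by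
  classical
  set X : ι × Fin 2 → Finset R := fun p => {r | f r p.1 = p.2} with hX
  have hsub : ∀ p q, X p ⊆ X q → p = q := by
    rintro ⟨i, v⟩ ⟨j, w⟩ h
    by_contra hne
    by_cases hij : i = j
    · subst hij
      obtain ⟨j, hj⟩ := exists_ne i
      obtain ⟨r, hr, -⟩ := hf i j hj.symm v 0
      have := h (show r ∈ X (i, v) by simp [hX, hr])
      simp only [hX, mem_filter_univ] at this
      exact hne (by rw [← hr, this])
    · obtain ⟨r, hr, hr'⟩ := hf i j hij v (w + 1)
      have := h (show r ∈ X (i, v) by simp [hX, hr])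
      simp only [hX, mem_filter_univ] at this
      exact (by decide : ∀ w : Fin 2, w ≠ w + 1) w (this.symm.trans hr')
  have hinj : Function.Injective X := fun p q h => hsub p q h.subset
  have hcard : #(univ.image X) = 2 * Fintype.card ι := by
    rw [card_image_of_injective _ hinj, card_univ, Fintype.card_prod, Fintype.card_fin, mul_comm]
  by_contra hv
  have := IsAntichain.card_add_le_choose_of_compl_mem (𝒜 := univ.image X) hk hR ?_ ?_
    ⟨X (i, v), mem_image_of_mem _ (mem_univ _), hv⟩
  · omega
  · intro A hA B hB hAB h
    simp only [coe_image, coe_univ, Set.image_univ, Set.mem_range] at hA hB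
    obtain ⟨p, rfl⟩ := hA
    obtain ⟨q, rfl⟩ := hB
    exact hAB (congrArg X (hsub p q h))
  · intro A hA
    obtain ⟨⟨i, v⟩, -, rfl⟩ := mem_image.1 hA
    refine mem_image.2 ⟨(i, v + 1), mem_univ _, ?_⟩
    ext r
    simp only [hX, mem_filter_univ, mem_compl]
    exact (by decide : ∀ u w : Fin 2, u = w + 1 ↔ ¬u = w) _ _

/-- A large two-covering array has at least `2 * k` rows. -/
theorem le_card_rows (hf : IsTwoCovering f) {k : ℕ} (hk : 2 ≤ k)
    (hι : (2 * k).choose k < 2 * Fintype.card ι + 2 * k) : 2 * k ≤ Fintype.card R := by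
  classical
  by_contra! hlt
  obtain ⟨d, hd⟩ := Nat.exists_eq_add_of_lt hlt
  set g : Fin 2 → R ⊕ Fin (d + 1) → ι → Fin 2 := fun u => Sum.elim f fun _ _ => u with hg
  have hgcov (u : Fin 2) : IsTwoCovering (g u) := fun i j hij v w =>
    let ⟨r, hr⟩ := hf i j hij v w
    ⟨.inl r, hr⟩
  obtain ⟨i⟩ : Nonempty ι := inferInstance
  have hfib (u : Fin 2) : #{r | f r i = 0} + #{_x : Fin (d + 1) | u = 0} = k := by
    rw [← (hgcov u).card_fiber_eq hk (by simp; omega) hι i 0, card_filter, card_filter,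
      card_filter, Fintype.sum_sum_type]
    rfl
  have h0 := hfib 0
  have h1 := hfib 1
  simp only [filter_true, one_ne_zero, filter_false, card_univ, Fintype.card_fin,
    card_empty] at h0 h1
  omega

end IsTwoCovering

/-- **Fisher's inequality**: sets of equal size `a` with equal pairwise intersections of size
`b < a` are at most as many as the points. -/
theorem card_le_card_of_card_inter_eq {R ι : Type*} [Fintype R] [DecidableEq R] [Fintype ι]
    {A : ι → Finset R} {a b : ℕ} (hba : b < a) (ha : ∀ i, #(A i) = a)
    (hb : ∀ i j, i ≠ j → #(A i ∩ A j) = b) : Fintype.card ι ≤ Fintype.card R := by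
  classical
  set x : ι → R → ℚ := fun i r => if r ∈ A i then 1 else 0 with hx
  have hdot (i j : ι) : ∑ r, x i r * x j r = b + if i = j then (a - b : ℚ) else 0 := by
    have : ∑ r, x i r * x j r = #(A i ∩ A j) := by
      simp [hx, ← ite_and, ← mem_inter, inter_comm]
    rw [this]
    split_ifs with h
    · subst h; simp [ha]
    · simp [hb i j h]
  have hli : LinearIndependent ℚ x := by
    rw [Fintype.linearIndependent_iff]
    intro g hg
    have hba' : (0 : ℚ) < a - b := sub_pos.2 (by exact_mod_cast hba)
    have key (j : ι) : b * ∑ i, g i + (a - b) * g j = 0 := by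
      have h0 : ∑ r, (∑ i, g i • x i) r * x j r = 0 := by rw [hg]; simp
      simp only [Finset.sum_apply, Pi.smul_apply, smul_eq_mul, sum_mul, mul_assoc] at h0
      rw [sum_comm] at h0
      simp only [← mul_sum, hdot, mul_add, sum_add_distrib, mul_ite, mul_zero, sum_ite_eq',
        mem_univ, if_true, ← sum_mul] at h0
      linarith
    have hsum : ∑ i, g i = 0 := by
      have h := sum_eq_zero fun j (_ : j ∈ univ) => key j
      rw [sum_add_distrib, ← mul_sum, sum_const, nsmul_eq_mul, ← mul_assoc, ← mul_sum,
        ← add_mul] at h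
      refine (mul_eq_zero.1 h).resolve_left (ne_of_gt ?_)
      positivity
    intro i
    have h := key i
    rw [hsum, mul_zero, zero_add] at h
    exact (mul_eq_zero.1 h).resolve_left hba'.ne'
  simpa using hli.fintype_card_le_finrank

/-- A three-covering array with many columns has at least `4 * k + 2` rows. -/
theorem le_card_rows_of_three_covering {R ι : Type*} [Fintype R] [Fintype ι] {C : R → ι → Fin 2}
    (hC : ∀ i j l, i ≠ j → i ≠ l → j ≠ l → ∀ u v w, ∃ r, C r i = u ∧ C r j = v ∧ C r l = w)
    {k : ℕ} (hk : 2 ≤ k) (hι : (2 * k).choose k + 2 < 2 * Fintype.card ι + 2 * k)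
    (hι' : 4 * k + 1 < Fintype.card ι) : 4 * k + 2 ≤ Fintype.card R := by
  classical
  by_contra! hR
  have hcard (c : ι) : Fintype.card {j // j ≠ c} = Fintype.card ι - 1 := by simp
  have hnt (c : ι) : Nontrivial {j // j ≠ c} :=
    Fintype.one_lt_card_iff_nontrivial.1 (by rw [hcard]; omega)
  have hder (c : ι) (v : Fin 2) :
      IsTwoCovering fun (r : {r // C r c = v}) (j : {j // j ≠ c}) => C r j := by
    intro i j hij u w
    obtain ⟨r, hr, hi, hj⟩ := hC c i j i.2.symm j.2.symm (Subtype.coe_injective.ne hij) v u w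
    exact ⟨⟨r, hr⟩, hi, hj⟩
  have hcard' (c : ι) : (2 * k).choose k < 2 * Fintype.card {j // j ≠ c} + 2 * k := by
    rw [hcard]; omega
  have hbal (c : ι) : ∃ v, #{r | C r c = v} = 2 * k := by
    have h0 := (hder c 0).le_card_rows hk (hcard' c)
    have h1 := (hder c 1).le_card_rows hk (hcard' c)
    rw [Fintype.card_subtype] at h0 h1
    have hsplit := card_filter_add_card_filter_not (s := (univ : Finset R)) (fun r => C r c = 0)
    have hnot : ({r | ¬C r c = 0} : Finset R) = ({r | C r c = 1} : Finset R) := by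
      ext r
      simp only [mem_filter_univ]
      exact (by decide : ∀ u : Fin 2, ¬u = 0 ↔ u = 1) _
    rw [hnot, card_univ] at hsplit
    rcases h0.eq_or_lt with h | h
    · exact ⟨0, h.symm⟩
    · exact ⟨1, by omega⟩
  choose s hs using hbal
  have hinter (i j : ι) (hij : i ≠ j) :
      #(({r | C r i = s i} : Finset R) ∩ ({r | C r j = s j} : Finset R)) = k := by
    have h := (hder i (s i)).card_fiber_eq hk (by rw [Fintype.card_subtype, hs]) (hcard' i)
      ⟨j, hij.symm⟩ (s j)
    rw [← h, ← card_map (Function.Embedding.subtype _)]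
    congr 1
    ext r
    simp
    tauto
  have := card_le_card_of_card_inter_eq (by omega) hs hinter
  omega

end Covering

section Arrays
open Finset

lemma ten_mul_le_choose {k : ℕ} (hk : 4 ≤ k) : 10 * k ≤ (2 * k).choose k := by
  rw [← Nat.centralBinom_eq_two_mul_choose]
  induction k, hk using Nat.le_induction with
  | base => decide
  | succ k hk ih =>
    have := Nat.succ_mul_centralBinom_succ k
    nlinarith

/-- The standard array shows that `2 * k` rows suffice for `(2 * k - 1).choose (k - 1)` columns. -/
theorem CAN_two_le {k n : ℕ} (hk : 2 ≤ k) (hn : n ≤ (2 * k - 1).choose (k - 1)) :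
    CAN 2 n 2 ≤ 2 * k := by
  obtain ⟨l, rfl⟩ := Nat.exists_eq_add_of_le' hk
  have hcard : #(powersetCard (l + 1) (univ : Finset (Fin (2 * l + 3)))) =
      (2 * (l + 2) - 1).choose (l + 2 - 1) := by simp; congr 1
  obtain ⟨g⟩ : Nonempty (Fin n ↪ powersetCard (l + 1) (univ : Finset (Fin (2 * l + 3)))) :=
    Function.Embedding.nonempty_of_card_le (by rwa [Fintype.card_fin, Fintype.card_coe, hcard])
  have hg (i : Fin n) : #(g i : Finset (Fin (2 * l + 3))) = l + 1 := (mem_powersetCard.1 (g i).2).2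
  have hdiff (i j : Fin n) (hij : i ≠ j) : ∃ r, r ∈ (g i).1 ∧ r ∉ (g j).1 := by
    by_contra! h
    exact hij (g.injective (Subtype.ext (eq_of_subset_of_card_le h (by rw [hg, hg]))))
  let C : Fin (2 * l + 3 + 1) → Fin n → Fin 2 :=
    Fin.cons (fun _ => 1) fun r i => if r ∈ (g i).1 then 1 else 0
  refine Nat.sInf_le ⟨C, fun cols hcols v => ?_⟩
  have hne : cols 0 ≠ cols 1 := hcols.ne (by decide)
  suffices ∃ r, C r (cols 0) = v 0 ∧ C r (cols 1) = v 1 by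
    exact this.imp fun r => Fin.forall_fin_two.2
  rcases (by decide : ∀ u : Fin 2, u = 0 ∨ u = 1) (v 0) with h0 | h0 <;>
  rcases (by decide : ∀ u : Fin 2, u = 0 ∨ u = 1) (v 1) with h1 | h1 <;> rw [h0, h1]
  · obtain ⟨r, hr⟩ : ∃ r, r ∉ (g (cols 0)).1 ∪ (g (cols 1)).1 := by
      by_contra! h
      have := card_union_le (g (cols 0)).1 (g (cols 1)).1
      rw [eq_univ_iff_forall.2 h, hg, hg, card_univ, Fintype.card_fin] at this
      omega
    rw [mem_union, not_or] at hr
    exact ⟨r.succ, by simp [C, hr]⟩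
  · obtain ⟨r, hr⟩ := hdiff _ _ hne.symm
    exact ⟨r.succ, by simp [C, hr]⟩
  · obtain ⟨r, hr⟩ := hdiff _ _ hne
    exact ⟨r.succ, by simp [C, hr]⟩
  · exact ⟨0, by simp [C]⟩

/-- Listing all rows gives a covering array. -/
theorem exists_isCoveringArray (n q t : ℕ) :
    ∃ m, ∃ C : Fin m → Fin n → Fin (q + 1), IsCoveringArray m n (q + 1) t C := by
  refine ⟨_, (Fintype.equivFin (Fin n → Fin (q + 1))).symm, fun cols hcols v => ?_⟩
  refine ⟨Fintype.equivFin _ (Function.extend cols v 0), fun j => ?_⟩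
  rw [Equiv.symm_apply_apply, hcols.extend_apply]

theorem IsCoveringArray.exists_row_three {N n q : ℕ} {C : Fin N → Fin n → Fin q}
    (hC : IsCoveringArray N n q 3 C) {i j l : Fin n} (hij : i ≠ j) (hil : i ≠ l) (hjl : j ≠ l)
    (u v w : Fin q) : ∃ r, C r i = u ∧ C r j = v ∧ C r l = w := by
  have hinj : Function.Injective ![i, j, l] := by
    intro a b
    fin_cases a <;> fin_cases b <;> simp [hij, hil, hjl, hij.symm, hil.symm, hjl.symm]
  obtain ⟨r, hr⟩ := hC _ hinj ![u, v, w]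
  exact ⟨r, hr 0, hr 1, hr 2⟩

end Arrays

/-- improved Roux bound, even case: for even `m ≥ 8` and
`binom(m-1, m/2-1) - m/2 < n ≤ binom(m-1, m/2-1)` we have
`CAN(3,n+1,2) ≥ 2·CAN(2,n,2) + 2`; equivalently there is no
`(2m+1) × (n+1)` binary 3-covering array. -/
theorem improved_roux_even (m n : ℕ) (hm : 8 ≤ m) (heven : Even m)
    (hn1 : (m-1).choose (m/2 - 1) < n + m/2)
    (hn2 : n ≤ (m-1).choose (m/2 - 1)) :
    2 * CAN 2 n 2 + 2 ≤ CAN 3 (n+1) 2 ∧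
    (∀ C : Fin (2*m+1) → Fin (n+1) → Fin 2, ¬ IsCoveringArray (2*m+1) (n+1) 2 3 C) := by
  obtain ⟨k, rfl⟩ := heven.two_dvd
  rw [Nat.mul_div_cancel_left k two_pos] at hn1 hn2
  have hchoose : (2 * k).choose k = 2 * (2 * k - 1).choose (k - 1) := by
    obtain ⟨l, rfl⟩ : ∃ l, k = l + 1 := ⟨k - 1, by omega⟩
    rw [show 2 * (l + 1) = 2 * l + 1 + 1 by ring, Nat.choose_succ_succ, Nat.choose_symm_half]
    simp only [Nat.add_sub_cancel]
    ring
  have hten := ten_mul_le_choose (k := k) (by omega)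
  have hrows {N : ℕ} {C : Fin N → Fin (n + 1) → Fin 2} (hC : IsCoveringArray N (n + 1) 2 3 C) :
      4 * k + 2 ≤ N := by
    have := le_card_rows_of_three_covering (k := k)
      (fun i j l hij hil hjl u v w => hC.exists_row_three hij hil hjl u v w) (by omega)
      (by rw [Fintype.card_fin]; omega) (by rw [Fintype.card_fin]; omega)
    rwa [Fintype.card_fin] at this
  refine ⟨?_, fun C hC => by have := hrows hC; omega⟩
  have hle : 4 * k + 2 ≤ CAN 3 (n + 1) 2 :=
    le_csInf (exists_isCoveringArray (n + 1) 1 3) fun N ⟨C, hC⟩ => hrows hC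
  have := CAN_two_le (k := k) (by omega) hn2
  omega
end

section
/- CAN(3,11,2) = 12, and the 12 × 11 binary 3-covering array is unique up to equivalence; that is, there exists a 12 × 11 binary 3-covering array, no 11 × 11 binary 3-covering array exists, and any two 12 × 11 binary 3-covering arrays are equivalent. -/
open Finset

section TwoCovering

variable {α ι : Type*} [Fintype α]

/-- The set of rows of `g` in which column `p.1` takes the value `p.2`. -/
def fiber (g : α → ι → Fin 2) (p : ι × Fin 2) : Finset α :=
  univ.filter fun r => g r p.1 = p.2

variable {g : α → ι → Fin 2}

@[simp]
theorem mem_fiber {p : ι × Fin 2} {r : α} : r ∈ fiber g p ↔ g r p.1 = p.2 := by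
  simp [fiber]

theorem eq_of_fiber_subset_fiber [Nontrivial ι]
    (h : ∀ i j, i ≠ j → ∀ x y, ∃ r, g r i = x ∧ g r j = y) {p q : ι × Fin 2}
    (hpq : fiber g p ⊆ fiber g q) : p = q := by
  obtain ⟨i, x⟩ := p
  obtain ⟨j, y⟩ := q
  have key : ∀ r, g r i = x → g r j = y := fun r hr => by
    simpa using hpq (show r ∈ fiber g (i, x) by simp [hr])
  by_cases hij : i = j
  · subst hij
    obtain ⟨k, hk⟩ := exists_ne i
    obtain ⟨r, hr, -⟩ := h i k hk.symm x 0
    rw [← hr, key r hr]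
  · obtain ⟨r, hr, hr'⟩ := h i j hij x (y + 1)
    exact absurd (hr'.symm.trans (key r hr)) ((by decide : ∀ y : Fin 2, y + 1 ≠ y) y)

theorem fiber_injective [Nontrivial ι]
    (h : ∀ i j, i ≠ j → ∀ x y, ∃ r, g r i = x ∧ g r j = y) : Function.Injective (fiber g) :=
  fun _ _ hpq => eq_of_fiber_subset_fiber h hpq.subset

variable [DecidableEq α] [Fintype ι]

theorem isAntichain_image_fiber [Nontrivial ι]
    (h : ∀ i j, i ≠ j → ∀ x y, ∃ r, g r i = x ∧ g r j = y) :
    IsAntichain (· ⊆ ·) (SetLike.coe (univ.image (fiber g))) := by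
  intro A hA B hB hAB hsub
  obtain ⟨p, -, rfl⟩ := mem_image.1 (mem_coe.1 hA)
  obtain ⟨q, -, rfl⟩ := mem_image.1 (mem_coe.1 hB)
  exact hAB (congrArg _ (eq_of_fiber_subset_fiber h hsub))

theorem card_image_fiber [Nontrivial ι]
    (h : ∀ i j, i ≠ j → ∀ x y, ∃ r, g r i = x ∧ g r j = y) :
    (univ.image (fiber g)).card = Fintype.card ι * 2 := by
  rw [card_image_of_injective _ (fiber_injective h)]
  simp

/-- A binary 2-covering array with ten columns has at least six rows. -/
theorem six_le_card_of_twoCovering (hι : Fintype.card ι = 10)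
    (h : ∀ i j, i ≠ j → ∀ x y, ∃ r, g r i = x ∧ g r j = y) : 6 ≤ Fintype.card α := by
  have : Nontrivial ι := Fintype.one_lt_card_iff_nontrivial.1 (by omega)
  have hs := (isAntichain_image_fiber h).sperner
  rw [card_image_fiber h, hι] at hs
  by_contra! hlt
  interval_cases Fintype.card α <;> revert hs <;> decide

/-- In a `6 × 10` binary 2-covering array the columns and their complements are
exactly the subsets of size three. -/
theorem image_fiber_eq_powersetCard (hι : Fintype.card ι = 10) (hα : Fintype.card α = 6)
    (h : ∀ i j, i ≠ j → ∀ x y, ∃ r, g r i = x ∧ g r j = y) :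
    univ.image (fiber g) = powersetCard 3 univ := by
  have : Nontrivial ι := Fintype.one_lt_card_iff_nontrivial.1 (by omega)
  have hcard := card_image_fiber h
  rw [hι] at hcard
  have hlym := lubell_yamamoto_meshalkin_inequality_sum_inv_choose (𝕜 := ℚ)
    (isAntichain_image_fiber h)
  rw [hα] at hlym
  refine eq_of_subset_of_card_le (fun A hA => mem_powersetCard.2 ⟨subset_univ _, ?_⟩) ?_
  · have hle : ∀ B ∈ univ.image (fiber g),
        (1 / 20 : ℚ) ≤ ((Nat.choose 6 B.card : ℕ) : ℚ)⁻¹ ∧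
          (B.card ≠ 3 → (1 / 20 : ℚ) < ((Nat.choose 6 B.card : ℕ) : ℚ)⁻¹) := by
      intro B _
      have hB : B.card ≤ 6 := hα ▸ card_le_univ B
      interval_cases B.card <;> norm_num [Nat.choose]
    by_contra hne
    have := sum_lt_sum (fun B hB => (hle B hB).1) ⟨A, hA, (hle A hA).2 hne⟩
    rw [sum_const, hcard] at this
    norm_num at this
    linarith
  · rw [hcard, card_powersetCard, card_univ, hα]
    decide

end TwoCovering

section ThreeCovering

variable {m n : ℕ} {C : Fin m → Fin n → Fin 2}

theorem IsCoveringArray.exists_row_s17 (hC : IsCoveringArray m n 2 3 C) {a b c : Fin n}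
    (hab : a ≠ b) (hac : a ≠ c) (hbc : b ≠ c) (x y z : Fin 2) :
    ∃ r, C r a = x ∧ C r b = y ∧ C r c = z := by
  obtain ⟨r, hr⟩ := hC ![a, b, c] (by
    intro i j
    fin_cases i <;> fin_cases j <;> simp [hab, hac, hbc, hab.symm, hac.symm, hbc.symm])
    ![x, y, z]
  exact ⟨r, hr 0, hr 1, hr 2⟩

/-- The rows of `C` taking the value `x` in column `a`, with column `a` deleted. -/
def derived (C : Fin m → Fin n → Fin 2) (a : Fin n) (x : Fin 2) :
    {r // C r a = x} → {j // j ≠ a} → Fin 2 :=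
  fun r j => C r j

@[simp]
theorem derived_apply {C : Fin m → Fin n → Fin 2} {a : Fin n} {x : Fin 2}
    (r : {r // C r a = x}) (j : {j // j ≠ a}) : derived C a x r j = C r j :=
  rfl

theorem IsCoveringArray.derived_twoCovering (hC : IsCoveringArray m n 2 3 C) (a : Fin n)
    (x : Fin 2) (i j : {j // j ≠ a}) (hij : i ≠ j) (y z : Fin 2) :
    ∃ r, derived C a x r i = y ∧ derived C a x r j = z := by
  obtain ⟨r, h, h'⟩ := hC.exists_row_s17 i.2.symm j.2.symm (Subtype.coe_ne_coe.2 hij) x y z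
  exact ⟨⟨r, h⟩, h'⟩

theorem card_eq_card_zero_add_card_one (C : Fin m → Fin n → Fin 2) (a : Fin n) :
    Fintype.card {r // C r a = 0} + Fintype.card {r // C r a = 1} = m := by
  rw [← Fintype.card_subtype_or_disjoint]
  · rw [Fintype.card_of_subtype univ] <;> simp
    intro r
    generalize C r a = x
    revert x
    decide
  · rw [Pi.disjoint_iff]
    intro r
    simp only [Prop.disjoint_iff, not_and]
    grind

end ThreeCovering

section ElevenColumns

theorem card_ne_fin_eleven (a : Fin 11) : Fintype.card {j // j ≠ a} = 10 := by
  simp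

theorem IsCoveringArray.six_le_card {m : ℕ} {C : Fin m → Fin 11 → Fin 2}
    (hC : IsCoveringArray m 11 2 3 C) (a : Fin 11) (x : Fin 2) :
    6 ≤ Fintype.card {r // C r a = x} :=
  six_le_card_of_twoCovering (card_ne_fin_eleven a) (hC.derived_twoCovering a x)

theorem IsCoveringArray.twelve_le {m : ℕ} {C : Fin m → Fin 11 → Fin 2}
    (hC : IsCoveringArray m 11 2 3 C) : 12 ≤ m := by
  have := card_eq_card_zero_add_card_one C 0
  have := hC.six_le_card 0 0
  have := hC.six_le_card 0 1
  omega

variable {C : Fin 12 → Fin 11 → Fin 2}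

theorem IsCoveringArray.card_eq_six (hC : IsCoveringArray 12 11 2 3 C) (a : Fin 11)
    (x : Fin 2) : Fintype.card {r // C r a = x} = 6 := by
  have := card_eq_card_zero_add_card_one C a
  have := hC.six_le_card a 0
  have := hC.six_le_card a 1
  obtain rfl | rfl : x = 0 ∨ x = 1 := by revert x; decide
  all_goals omega

theorem IsCoveringArray.image_fiber_derived (hC : IsCoveringArray 12 11 2 3 C) (a : Fin 11)
    (x : Fin 2) : univ.image (fiber (derived C a x)) = powersetCard 3 univ :=
  image_fiber_eq_powersetCard (card_ne_fin_eleven a) (hC.card_eq_six a x)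
    (hC.derived_twoCovering a x)

theorem IsCoveringArray.card_fiber_derived (hC : IsCoveringArray 12 11 2 3 C) (a : Fin 11)
    (x : Fin 2) (p : {j // j ≠ a} × Fin 2) : (fiber (derived C a x) p).card = 3 := by
  have h : fiber (derived C a x) p ∈ univ.image (fiber (derived C a x)) :=
    mem_image_of_mem _ (mem_univ p)
  rw [hC.image_fiber_derived] at h
  exact (mem_powersetCard.1 h).2

end ElevenColumns

section Blocks

/-- The subsets of size three of `Fin 6` containing `0`. -/
def topBlocks : Fin 10 → Finset (Fin 6) :=
  ![{0, 1, 2}, {0, 3, 4}, {0, 3, 5}, {0, 4, 5}, {0, 1, 3}, {0, 1, 4}, {0, 1, 5}, {0, 2, 3},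
    {0, 2, 4}, {0, 2, 5}]

/-- The blocks of the 2-(6, 3, 2) design. -/
def bottomBlocks : Fin 10 → Finset (Fin 6) :=
  ![{0, 1, 2}, {0, 1, 3}, {0, 2, 4}, {1, 2, 5}, {1, 4, 5}, {2, 3, 4}, {0, 3, 5}, {2, 3, 5},
    {0, 4, 5}, {1, 3, 4}]

/-- The permutation of the indices of `topBlocks` induced by the transposition of `1` and `2`. -/
def blockSwap : Equiv.Perm (Fin 10) :=
  Equiv.swap 4 7 * Equiv.swap 5 8 * Equiv.swap 6 9

theorem swap_mem_topBlocks_blockSwap (r : Fin 6) (k : Fin 10) :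
    Equiv.swap 1 2 r ∈ topBlocks (blockSwap k) ↔ r ∈ topBlocks k := by
  revert r k
  decide

theorem exists_eq_insert_pair {β : Type*} [DecidableEq β] {A : Finset β} (hA : A.card = 3)
    {p q : β} (hp : p ∈ A) (hq : q ∈ A) (hpq : p ≠ q) :
    ∃ s, s ≠ p ∧ s ≠ q ∧ A = {p, q, s} := by
  obtain ⟨s, hs⟩ := card_eq_one.1 (show (A \ {p, q}).card = 1 by
    rw [card_sdiff_of_subset (by simp [insert_subset_iff, hp, hq]), card_pair hpq, hA])
  have := mem_singleton_self s
  rw [← hs] at this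
  refine ⟨s, by grind, by grind, ?_⟩
  ext t
  have := congrArg (t ∈ ·) hs
  grind

/-- Three blocks of size three on six points which pairwise meet in one point consist of the
vertices of a triangle, together with an additional point on each side. -/
theorem exists_triangle {β : Type*} [DecidableEq β] [Fintype β] (hβ : Fintype.card β = 6)
    {B C D : Finset β} (hB : B.card = 3) (hC : C.card = 3) (hD : D.card = 3)
    (hBC : (B ∩ C).card = 1) (hBD : (B ∩ D).card = 1) (hCD : (C ∩ D).card = 1) :
    ∃ e : Fin 6 ≃ β, B = ({0, 1, 3} : Finset (Fin 6)).map e.toEmbedding ∧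
      C = ({0, 2, 4} : Finset (Fin 6)).map e.toEmbedding ∧
      D = ({1, 2, 5} : Finset (Fin 6)).map e.toEmbedding := by
  have h0 : (B ∩ C ∩ D).card = 0 := by
    have h1 := card_union_add_card_inter (B ∪ C) D
    have h2 := card_union_add_card_inter B C
    have h3 := card_union_add_card_inter (B ∩ D) (C ∩ D)
    rw [← union_inter_distrib_right, ← inter_inter_distrib_right] at h3
    have := card_le_univ (B ∪ C ∪ D)
    omega
  rw [card_eq_zero, eq_empty_iff_forall_notMem] at h0
  obtain ⟨x, hx⟩ := card_eq_one.1 hBC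
  obtain ⟨y, hy⟩ := card_eq_one.1 hBD
  obtain ⟨z, hz⟩ := card_eq_one.1 hCD
  simp only [Finset.ext_iff, mem_inter, mem_singleton] at hx hy hz h0
  obtain ⟨hxB, hxC⟩ := (hx x).2 rfl
  obtain ⟨hyB, hyD⟩ := (hy y).2 rfl
  obtain ⟨hzC, hzD⟩ := (hz z).2 rfl
  have hxy : x ≠ y := fun h => h0 x ⟨⟨hxB, hxC⟩, h ▸ hyD⟩
  have hxz : x ≠ z := fun h => h0 x ⟨⟨hxB, hxC⟩, h ▸ hzD⟩
  have hyz : y ≠ z := fun h => h0 y ⟨⟨hyB, h ▸ hzC⟩, hyD⟩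
  obtain ⟨u, hux, huy, hBu⟩ := exists_eq_insert_pair hB hxB hyB hxy
  obtain ⟨v, hvx, hvz, hCv⟩ := exists_eq_insert_pair hC hxC hzC hxz
  obtain ⟨w, hwy, hwz, hDw⟩ := exists_eq_insert_pair hD hyD hzD hyz
  have huB : u ∈ B := by simp [hBu]
  have hvC : v ∈ C := by simp [hCv]
  have hwD : w ∈ D := by simp [hDw]
  have huC : u ∉ C := fun h => hux ((hx u).1 ⟨huB, h⟩)
  have huD : u ∉ D := fun h => huy ((hy u).1 ⟨huB, h⟩)
  have hvD : v ∉ D := fun h => hvz ((hz v).1 ⟨hvC, h⟩)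
  have hwB : w ∉ B := fun h => hwy ((hy w).1 ⟨h, hwD⟩)
  have hinj : Function.Injective ![x, y, z, u, v, w] := by
    rw [← List.nodup_ofFn]
    have hxu := hux.symm
    have hxv := hvx.symm
    have hxw : x ≠ w := fun h => hwB (h ▸ hxB)
    have hyu := huy.symm
    have hyv : y ≠ v := fun h => hvD (h ▸ hyD)
    have hyw := hwy.symm
    have hzu : z ≠ u := fun h => huC (h ▸ hzC)
    have hzv := hvz.symm
    have hzw := hwz.symm
    have huv : u ≠ v := fun h => huC (h ▸ hvC)
    have huw : u ≠ w := fun h => huD (h ▸ hwD)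
    have hvw : v ≠ w := fun h => hvD (h ▸ hwD)
    simp [*]
  refine ⟨Equiv.ofBijective _ ((Fintype.bijective_iff_injective_and_card _).2 ⟨hinj, by simp [hβ]⟩),
    ?_, ?_, ?_⟩ <;> simpa

/-- A block of size three is determined, up to two choices, by the sizes of its intersections with
the blocks of a triangle and the block of its vertices. -/
theorem eq_bottomBlocks_of_card_inter : ∀ A : Finset (Fin 6), A.card = 3 →
    ((A ∩ {0, 1, 3}).card = 2 ∧ (A ∩ {0, 2, 4}).card = 2 ∧ (A ∩ {1, 2, 5}).card = 2 →
      A = bottomBlocks 0) ∧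
    ((A ∩ {0, 1, 3}).card = 1 ∧ (A ∩ {0, 2, 4}).card = 1 ∧ (A ∩ {1, 2, 5}).card = 2 ∧
      (A ∩ {0, 1, 2}).card = 1 → A = bottomBlocks 4 ∨ A = bottomBlocks 7) ∧
    ((A ∩ {0, 1, 3}).card = 1 ∧ (A ∩ {0, 2, 4}).card = 2 ∧ (A ∩ {1, 2, 5}).card = 1 ∧
      (A ∩ {0, 1, 2}).card = 1 → A = bottomBlocks 5 ∨ A = bottomBlocks 8) ∧
    ((A ∩ {0, 1, 3}).card = 2 ∧ (A ∩ {0, 2, 4}).card = 1 ∧ (A ∩ {1, 2, 5}).card = 1 ∧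
      (A ∩ {0, 1, 2}).card = 1 → A = bottomBlocks 6 ∨ A = bottomBlocks 9) := by
  decide

theorem eq_bottomBlocks_or_eq_bottomBlocks_blockSwap {W : Fin 10 → Finset (Fin 6)}
    (hcard : ∀ k, (W k).card = 3)
    (hinter : ∀ k l, k ≠ l → (W k ∩ W l).card + (topBlocks k ∩ topBlocks l).card = 3)
    (h1 : W 1 = {0, 1, 3}) (h2 : W 2 = {0, 2, 4}) (h3 : W 3 = {1, 2, 5}) :
    W = bottomBlocks ∨ W = bottomBlocks ∘ blockSwap := by
  have hi : ∀ k l n, k ≠ l → (topBlocks k ∩ topBlocks l).card + n = 3 → (W k ∩ W l).card = n := by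
    intro k l n hkl h
    have := hinter k l hkl
    omega
  have h0 : W 0 = bottomBlocks 0 := (eq_bottomBlocks_of_card_inter _ (hcard 0)).1 <| by
    rw [← h1, ← h2, ← h3]
    refine ⟨hi _ _ _ ?_ ?_, hi _ _ _ ?_ ?_, hi _ _ _ ?_ ?_⟩ <;> decide
  have h0' : W 0 = {0, 1, 2} := h0
  have h47 : ∀ k, k = 4 ∨ k = 7 → W k = bottomBlocks 4 ∨ W k = bottomBlocks 7 := fun k hk =>
    (eq_bottomBlocks_of_card_inter _ (hcard k)).2.1 <| by
      rw [← h1, ← h2, ← h3, ← h0']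
      refine ⟨hi _ _ _ ?_ ?_, hi _ _ _ ?_ ?_, hi _ _ _ ?_ ?_, hi _ _ _ ?_ ?_⟩ <;> revert k <;>
        decide
  have h58 : ∀ k, k = 5 ∨ k = 8 → W k = bottomBlocks 5 ∨ W k = bottomBlocks 8 := fun k hk =>
    (eq_bottomBlocks_of_card_inter _ (hcard k)).2.2.1 <| by
      rw [← h1, ← h2, ← h3, ← h0']
      refine ⟨hi _ _ _ ?_ ?_, hi _ _ _ ?_ ?_, hi _ _ _ ?_ ?_, hi _ _ _ ?_ ?_⟩ <;> revert k <;>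
        decide
  have h69 : ∀ k, k = 6 ∨ k = 9 → W k = bottomBlocks 6 ∨ W k = bottomBlocks 9 := fun k hk =>
    (eq_bottomBlocks_of_card_inter _ (hcard k)).2.2.2 <| by
      rw [← h1, ← h2, ← h3, ← h0']
      refine ⟨hi _ _ _ ?_ ?_, hi _ _ _ ?_ ?_, hi _ _ _ ?_ ?_, hi _ _ _ ?_ ?_⟩ <;> revert k <;>
        decide
  have hne : ∀ k l A B, k ≠ l → W k = A → W l = B →
      (A ∩ B).card + (topBlocks k ∩ topBlocks l).card ≠ 3 → False := by
    rintro k l A B hkl rfl rfl h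
    exact h (hinter k l hkl)
  rcases h47 4 (by decide) with h4 | h4
  · left
    have h7 := (h47 7 (by decide)).resolve_left fun h => hne 4 7 _ _ (by decide) h4 h (by decide)
    have h5 := (h58 5 (by decide)).resolve_right fun h => hne 4 5 _ _ (by decide) h4 h (by decide)
    have h6 := (h69 6 (by decide)).resolve_right fun h => hne 4 6 _ _ (by decide) h4 h (by decide)
    have h8 := (h58 8 (by decide)).resolve_left fun h => hne 7 8 _ _ (by decide) h7 h (by decide)
    have h9 := (h69 9 (by decide)).resolve_left fun h => hne 7 9 _ _ (by decide) h7 h (by decide)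
    funext k
    fin_cases k
    exacts [h0, h1, h2, h3, h4, h5, h6, h7, h8, h9]
  · right
    have h7 := (h47 7 (by decide)).resolve_right fun h => hne 4 7 _ _ (by decide) h4 h (by decide)
    have h5 := (h58 5 (by decide)).resolve_left fun h => hne 4 5 _ _ (by decide) h4 h (by decide)
    have h6 := (h69 6 (by decide)).resolve_left fun h => hne 4 6 _ _ (by decide) h4 h (by decide)
    have h8 := (h58 8 (by decide)).resolve_right fun h => hne 7 8 _ _ (by decide) h7 h (by decide)
    have h9 := (h69 9 (by decide)).resolve_right fun h => hne 7 9 _ _ (by decide) h7 h (by decide)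
    funext k
    fin_cases k
    exacts [h0, h1, h2, h3, h4, h5, h6, h7, h8, h9]

theorem exists_equiv_bottomBlocks {β : Type*} [DecidableEq β] [Fintype β]
    (hβ : Fintype.card β = 6) {U : Fin 10 → Finset β} (hcard : ∀ k, (U k).card = 3)
    (hinter : ∀ k l, k ≠ l → (U k ∩ U l).card + (topBlocks k ∩ topBlocks l).card = 3) :
    ∃ e : Fin 6 ≃ β, (∀ k r, e r ∈ U k ↔ r ∈ bottomBlocks k) ∨
      ∀ k r, e r ∈ U k ↔ r ∈ bottomBlocks (blockSwap k) := by
  have hi : ∀ k l, k ≠ l → (topBlocks k ∩ topBlocks l).card = 2 → (U k ∩ U l).card = 1 := by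
    intro k l hkl h
    have := hinter k l hkl
    omega
  obtain ⟨e, h1, h2, h3⟩ := exists_triangle hβ (hcard 1) (hcard 2) (hcard 3)
    (hi 1 2 (by decide) (by decide)) (hi 1 3 (by decide) (by decide))
    (hi 2 3 (by decide) (by decide))
  refine ⟨e, ?_⟩
  have hcancel : ∀ A : Finset (Fin 6), (A.map e.toEmbedding).map e.symm.toEmbedding = A := by
    intro A
    ext
    simp
  have hmem : ∀ k r, e r ∈ U k ↔ r ∈ (U k).map e.symm.toEmbedding := by simp
  rcases eq_bottomBlocks_or_eq_bottomBlocks_blockSwap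
    (W := fun k => (U k).map e.symm.toEmbedding) (by simpa using hcard)
    (fun k l hkl => by rw [← map_inter, card_map]; exact hinter k l hkl)
    (by simp only [h1, hcancel]) (by simp only [h2, hcancel]) (by simp only [h3, hcancel])
    with h | h
  · left
    intro k r
    rw [hmem, congrFun h k]
  · right
    intro k r
    rw [hmem, congrFun h k, Function.comp_apply]

end Blocks

section Uniqueness

variable {C : Fin 12 → Fin 11 → Fin 2}

theorem card_fiber_derived_inter (a : Fin 11) (x : Fin 2) (p q : {j // j ≠ a} × Fin 2) :
    (fiber (derived C a x) p ∩ fiber (derived C a x) q).card =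
      (univ.filter fun r => C r a = x ∧ C r p.1 = p.2 ∧ C r q.1 = q.2).card := by
  rw [← card_map (Function.Embedding.subtype _)]
  congr 1
  ext r
  simp only [mem_map, mem_inter, mem_fiber, derived_apply, mem_filter_univ]
  exact ⟨by rintro ⟨s, hs, rfl⟩; exact ⟨s.2, hs⟩, fun ⟨h, hr⟩ => ⟨⟨r, h⟩, hr, rfl⟩⟩

theorem IsCoveringArray.card_inter_fiber_add (hC : IsCoveringArray 12 11 2 3 C) {a : Fin 11}
    {p q : {j // j ≠ a} × Fin 2} (hpq : p.1 ≠ q.1) :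
    (fiber (derived C a 0) p ∩ fiber (derived C a 0) q).card +
      (fiber (derived C a 1) p ∩ fiber (derived C a 1) q).card = 3 := by
  let q' : {j // j ≠ (p.1 : Fin 11)} × Fin 2 := (⟨q.1, Subtype.coe_ne_coe.2 hpq.symm⟩, q.2)
  rw [← hC.card_fiber_derived p.1 p.2 q', ← inter_self (fiber _ q'), card_fiber_derived_inter,
    card_fiber_derived_inter, card_fiber_derived_inter, ← card_union_of_disjoint, ← filter_or]
  · congr 1
    ext r
    have : C r a = 0 ∨ C r a = 1 := by
      generalize C r a = x
      revert x
      decide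
    simp only [mem_filter_univ, q']
    tauto
  · rw [disjoint_filter]
    rintro r - ⟨h, -⟩ ⟨h', -⟩
    exact absurd (h.symm.trans h') (by decide)

/-- The incidence relation of the normal form of a `12 × 11` binary 3-covering array. -/
def normalForm : Fin 6 ⊕ Fin 6 → Option (Fin 10) → Prop
  | .inl _, none => True
  | .inr _, none => False
  | .inl r, some k => r ∈ topBlocks k
  | .inr r, some k => r ∈ bottomBlocks k

theorem IsCoveringArray.exists_normalForm_or (hC : IsCoveringArray 12 11 2 3 C) :
    ∃ (e : Fin 6 ⊕ Fin 6 ≃ Fin 12) (d : Option (Fin 10) ≃ Fin 11) (c : Option (Fin 10) → Fin 2),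
      (∀ r, C (e (.inl r)) (d none) = c none) ∧ (∀ r, C (e (.inr r)) (d none) ≠ c none) ∧
      (∀ r k, C (e (.inl r)) (d (some k)) = c (some k) ↔ r ∈ topBlocks k) ∧
      ((∀ r k, C (e (.inr r)) (d (some k)) = c (some k) ↔ r ∈ bottomBlocks k) ∨
        ∀ r k, C (e (.inr r)) (d (some k)) = c (some k) ↔ r ∈ bottomBlocks (blockSwap k)) := by
  let e₁ : Fin 6 ≃ {r // C r 0 = 1} := (Fintype.equivFinOfCardEq (hC.card_eq_six 0 1)).symm
  have hp : ∀ k, ∃ p, fiber (derived C 0 1) p = (topBlocks k).map e₁.toEmbedding := by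
    intro k
    have hk : (topBlocks k).map e₁.toEmbedding ∈ univ.image (fiber (derived C 0 1)) := by
      rw [hC.image_fiber_derived, mem_powersetCard, card_map]
      exact ⟨subset_univ _, by revert k; decide⟩
    simpa using hk
  choose p hp using hp
  have hmem : ∀ k r, C (e₁ r) (p k).1 = (p k).2 ↔ r ∈ topBlocks k := by
    intro k r
    have : e₁ r ∈ fiber (derived C 0 1) (p k) ↔ r ∈ topBlocks k := by simp [hp]
    simpa using this
  have hpne : ∀ k l, k ≠ l → (p k).1 ≠ (p l).1 := by
    intro k l hkl h
    have h0 : ∀ k, 0 ∈ topBlocks k := by decide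
    have h2 : (p k).2 = (p l).2 := by
      rw [← (hmem k 0).2 (h0 k), ← (hmem l 0).2 (h0 l), h]
    have h3 := hp k
    rw [Prod.ext h h2, hp l] at h3
    exact hkl ((by decide : Function.Injective topBlocks) (map_injective _ h3).symm)
  obtain ⟨e₀, he₀⟩ := exists_equiv_bottomBlocks (hC.card_eq_six 0 0)
    (fun k => hC.card_fiber_derived 0 0 (p k)) (fun k l hkl => by
      rw [← hC.card_inter_fiber_add (hpne k l hkl), hp, hp, ← map_inter, card_map])
  simp only [mem_fiber, derived_apply] at he₀
  have he : Function.Injective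
      (Sum.elim (fun r => (e₁ r : Fin 12)) fun r => (e₀ r : Fin 12)) := by
    refine (Subtype.val_injective.comp e₁.injective).sumElim
      (Subtype.val_injective.comp e₀.injective) fun r s h => ?_
    have h1 := (e₁ r).2
    rw [show (e₁ r : Fin 12) = e₀ s from h, (e₀ s).2] at h1
    exact absurd h1 (by decide)
  have hd : Function.Injective
      (fun o : Option (Fin 10) => o.elim (0 : Fin 11) fun k => (p k).1) := by
    rintro (_ | k) (_ | l) h
    · rfl
    · exact absurd h.symm (p l).1.2
    · exact absurd h (p k).1.2
    · by_contra hkl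
      exact hpne k l (fun h => hkl (congrArg some h)) (Subtype.ext h)
  refine ⟨Equiv.ofBijective _ ((Fintype.bijective_iff_injective_and_card _).2 ⟨he, by simp⟩),
    Equiv.ofBijective _ ((Fintype.bijective_iff_injective_and_card _).2 ⟨hd, by simp⟩),
    fun o => o.elim 1 fun k => (p k).2, fun r => (e₁ r).2, fun r h => ?_,
    fun r k => hmem k r, ?_⟩
  · exact absurd ((e₀ r).2.symm.trans h) (zero_ne_one (α := Fin 2))
  · exact he₀.imp (fun h r k => h k r) fun h r k => h k r

theorem IsCoveringArray.exists_normalForm (hC : IsCoveringArray 12 11 2 3 C) :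
    ∃ (e : Fin 6 ⊕ Fin 6 ≃ Fin 12) (d : Option (Fin 10) ≃ Fin 11) (c : Option (Fin 10) → Fin 2),
      ∀ r j, C (e r) (d j) = c j ↔ normalForm r j := by
  obtain ⟨e, d, c, h1, h0, htop, h | h⟩ := hC.exists_normalForm_or
  · refine ⟨e, d, c, ?_⟩
    rintro (r | r) (_ | k)
    exacts [iff_of_true (h1 r) trivial, htop r k, iff_of_false (h0 r) id, h r k]
  · refine ⟨(Equiv.sumCongr (Equiv.swap 1 2) (Equiv.refl _)).trans e,
      (Equiv.optionCongr blockSwap).trans d, c ∘ Equiv.optionCongr blockSwap, ?_⟩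
    have hinv : ∀ k, blockSwap (blockSwap k) = k := by decide
    rintro (r | r) (_ | k)
    · exact iff_of_true (h1 _) trivial
    · exact (htop _ _).trans (swap_mem_topBlocks_blockSwap r k)
    · exact iff_of_false (h0 _) id
    · refine (h r (blockSwap k)).trans ?_
      rw [hinv]
      rfl

theorem IsCoveringArray.caEquiv {C' : Fin 12 → Fin 11 → Fin 2}
    (hC : IsCoveringArray 12 11 2 3 C) (hC' : IsCoveringArray 12 11 2 3 C') : CAEquiv C C' := by
  obtain ⟨e, d, c, h⟩ := hC.exists_normalForm
  obtain ⟨e', d', c', h'⟩ := hC'.exists_normalForm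
  refine ⟨e'.symm.trans e, d'.symm.trans d,
    fun i => Equiv.swap (c (d'.symm i)) (c' (d'.symm i)), fun r i => ?_⟩
  have key : ∀ x y z w : Fin 2, (x = z ↔ y = w) → y = Equiv.swap z w x := by decide
  refine key _ _ _ _ ((h _ _).trans ?_)
  rw [← h']
  simp

end Uniqueness

section Existence

/-- The quadratic residues modulo eleven. -/
def residues : Finset (Fin 11) := {1, 3, 4, 5, 9}

/-- The incidence matrix of the Paley biplane of order eleven below a row of ones. -/
def paleyArray : Fin 12 → Fin 11 → Fin 2 :=
  Fin.cases (fun _ => 1) fun i j => if i + j ∈ residues then 1 else 0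

theorem exists_translate_residues :
    ∀ b c : Fin 11, b ≠ 0 ∧ c ≠ 0 ∧ b ≠ c → ∀ x y z : Prop, ∀ [Decidable x] [Decidable y]
      [Decidable z], (x ∧ y ∧ z) ∨ ∃ i,
        (i ∈ residues ↔ x) ∧ (i + b ∈ residues ↔ y) ∧ (i + c ∈ residues ↔ z) := by
  have h : ∀ b c : Fin 11, b ≠ 0 ∧ c ≠ 0 ∧ b ≠ c → ∀ x y z : Bool,
      (x ∧ y ∧ z) ∨ ∃ i,
        (i ∈ residues ↔ x) ∧ (i + b ∈ residues ↔ y) ∧ (i + c ∈ residues ↔ z) := by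
    decide +kernel
  intro b c hbc x y z _ _ _
  simpa using h b c hbc (decide x) (decide y) (decide z)

theorem isCoveringArray_paleyArray : IsCoveringArray 12 11 2 3 paleyArray := by
  intro cols hcols v
  have hz : ∀ x : Fin 2, x ≠ 1 → x = 0 := by decide
  obtain h | ⟨i, h⟩ := exists_translate_residues (cols 1 - cols 0) (cols 2 - cols 0)
    ⟨sub_ne_zero.2 (hcols.ne (by decide)), sub_ne_zero.2 (hcols.ne (by decide)),
      fun h => hcols.ne (show (1 : Fin 3) ≠ 2 by decide) (sub_left_injective h)⟩
    (v 0 = 1) (v 1 = 1) (v 2 = 1)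
  · refine ⟨0, fun j => ?_⟩
    fin_cases j
    exacts [h.1.symm, h.2.1.symm, h.2.2.symm]
  · refine ⟨(i - cols 0).succ, fun j => ?_⟩
    have hj : i - cols 0 + cols j ∈ residues ↔ v j = 1 := by
      simp only [← add_sub_assoc, sub_add_eq_add_sub] at h ⊢
      fin_cases j
      exacts [by simpa using h.1, h.2.1, h.2.2]
    simp only [paleyArray, Fin.cases_succ]
    split_ifs <;> grind

end Existence

/-- `CAN(3,11,2) = 12`: a `12 × 11` binary 3-covering array exists, no
`11 × 11` binary 3-covering array exists, and any two `12 × 11` binary 3-covering arrays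
are equivalent. -/
theorem ca_12_11_unique :
    CAN 3 11 2 = 12 ∧
    (∃ C : Fin 12 → Fin 11 → Fin 2, IsCoveringArray 12 11 2 3 C) ∧
    (∀ C : Fin 11 → Fin 11 → Fin 2, ¬ IsCoveringArray 11 11 2 3 C) ∧
    (∀ C C' : Fin 12 → Fin 11 → Fin 2, IsCoveringArray 12 11 2 3 C →
      IsCoveringArray 12 11 2 3 C' → CAEquiv C C') := by
  refine ⟨le_antisymm (Nat.sInf_le ⟨_, isCoveringArray_paleyArray⟩) ?_,
    ⟨_, isCoveringArray_paleyArray⟩, fun C hC => absurd hC.twelve_le (by decide),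
    fun C C' hC hC' => hC.caEquiv hC'⟩
  obtain ⟨C, hC⟩ := Nat.sInf_mem
    (s := {m | ∃ C : Fin m → Fin 11 → Fin 2, IsCoveringArray m 11 2 3 C})
    ⟨12, _, isCoveringArray_paleyArray⟩
  exact hC.twelve_le
end
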